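/- arXiv:2006.08667 — 5 statements merged into one kernel-verified Lean document; each statement's English description precedes it below -/
import Mathlib

section
/- Let L : ℝⁿ × ℝᵐ → ℝ be twice continuously differentiable and ρ-weakly convex–weakly concave with ρ > 0, let η > ρ, and suppose: (i) ‖∇²L(z)‖ ≤ β for all z; (ii) ∇²L is H-Lipschitz, i.e. ‖∇²L(z) − ∇²L(z̄)‖ ≤ H‖z − z̄‖ for all z, z̄; (iii) ‖∇²_{xy}L(z)‖ ≤ δ for all z. Let z₀ = (x₀, y₀) and α₀ > 0 be such that the interaction dominance inequalities hold at the single point z₀ with parameter α₀ in both x and y: ∇²_{xx}L(z₀) + ∇²_{xy}L(z₀)(ηI − ∇²_{yy}L(z₀))⁻¹∇²_{yx}L(z₀) ⪰ α₀I and −∇²_{yy}L(z₀) + ∇²_{yx}L(z₀)(ηI + ∇²_{xx}L(z₀))⁻¹∇²_{xy}L(z₀) ⪰ α₀I. Suppose further ‖∇L(z₀)‖ ≤ α₀(η−ρ) / (2·(1 + 4√2(η + α₀/2)/α₀ + 4√2β(η + α₀/2)/(α₀(η−ρ)))·H·(1 + 2δ/(η−ρ) + δ²/(η−ρ)²)) and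 λ ∈ (0,1] satisfies λ ≤ 2·min{1, (η/ρ − 1)²}/(2η/α₀ + 1). Then the damped proximal point method started at (x₀, y₀) converges linearly to a stationary point (x*, y*) of L with ‖(x_k − x*, y_k − y*)‖² ≤ (1 − 2λ/(2η/α₀ + 1) + λ²/min{1, (η/ρ − 1)²})^k · ‖(x₀ − x*, y₀ − y*)‖². -/
open Filter Topology Metric
open scoped RealInnerProductSpace

noncomputable section

abbrev Eu (n : ℕ) : Type := EuclideanSpace ℝ (Fin n)

noncomputable def gradx {n m : ℕ} (L : Eu n × Eu m → ℝ) (z : Eu n × Eu m) : Eu n :=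
  gradient (fun u => L (u, z.2)) z.1

noncomputable def grady {n m : ℕ} (L : Eu n × Eu m → ℝ) (z : Eu n × Eu m) : Eu m :=
  gradient (fun v => L (z.1, v)) z.2

noncomputable def Hxx {n m : ℕ} (L : Eu n × Eu m → ℝ) (z : Eu n × Eu m) : Eu n →L[ℝ] Eu n :=
  fderiv ℝ (fun x => gradient (fun u => L (u, z.2)) x) z.1

noncomputable def Hxy {n m : ℕ} (L : Eu n × Eu m → ℝ) (z : Eu n × Eu m) : Eu m →L[ℝ] Eu n :=
  fderiv ℝ (fun y => gradient (fun u => L (u, y)) z.1) z.2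

noncomputable def Hyx {n m : ℕ} (L : Eu n × Eu m → ℝ) (z : Eu n × Eu m) : Eu n →L[ℝ] Eu m :=
  fderiv ℝ (fun x => gradient (fun v => L (x, v)) z.2) z.1

noncomputable def Hyy {n m : ℕ} (L : Eu n × Eu m → ℝ) (z : Eu n × Eu m) : Eu m →L[ℝ] Eu m :=
  fderiv ℝ (fun y => gradient (fun v => L (z.1, v)) y) z.2

def WeaklyConvexConcave {n m : ℕ} (ρ : ℝ) (L : Eu n × Eu m → ℝ) : Prop :=
  ∀ z : Eu n × Eu m,
    (∀ v : Eu n, -ρ * ‖v‖ ^ 2 ≤ ⟪(Hxx L z) v, v⟫) ∧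
    (∀ w : Eu m, ⟪(Hyy L z) w, w⟫ ≤ ρ * ‖w‖ ^ 2)

def IntDomX {n m : ℕ} (η α : ℝ) (L : Eu n × Eu m → ℝ) : Prop :=
  ∀ z : Eu n × Eu m, ∀ v : Eu n,
    α * ‖v‖ ^ 2 ≤
      ⟪(Hxx L z) v +
        (Hxy L z) ((Ring.inverse (η • (1 : Eu m →L[ℝ] Eu m) - Hyy L z)) ((Hyx L z) v)), v⟫

def IntDomY {n m : ℕ} (η α : ℝ) (L : Eu n × Eu m → ℝ) : Prop :=
  ∀ z : Eu n × Eu m, ∀ w : Eu m,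
    α * ‖w‖ ^ 2 ≤
      ⟪-((Hyy L z) w) +
        (Hyx L z) ((Ring.inverse (η • (1 : Eu n →L[ℝ] Eu n) + Hxx L z)) ((Hxy L z) w)), w⟫

noncomputable def proxObj {n m : ℕ} (η : ℝ) (L : Eu n × Eu m → ℝ) (z w : Eu n × Eu m) : ℝ :=
  L w + η / 2 * ‖w.1 - z.1‖ ^ 2 - η / 2 * ‖w.2 - z.2‖ ^ 2

def IsProxPoint {n m : ℕ} (η : ℝ) (L : Eu n × Eu m → ℝ) (z w : Eu n × Eu m) : Prop :=
  (∀ v : Eu m, proxObj η L z (w.1, v) ≤ proxObj η L z w) ∧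
  (∀ u : Eu n, proxObj η L z w ≤ proxObj η L z (u, w.2))

noncomputable def saddleEnv {n m : ℕ} (η : ℝ) (L : Eu n × Eu m → ℝ)
    (prox : Eu n × Eu m → Eu n × Eu m) (z : Eu n × Eu m) : ℝ :=
  proxObj η L z (prox z)

noncomputable def moreau {n : ℕ} (η : ℝ) (f : Eu n → ℝ) (x : Eu n) : ℝ :=
  ⨅ u : Eu n, (f u + η / 2 * ‖u - x‖ ^ 2)

noncomputable def lyap {n m : ℕ} (η : ℝ) (L : Eu n × Eu m → ℝ) (z : Eu n × Eu m) : ℝ :=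
  -(moreau η (fun v => -L (z.1, v)) z.2) - moreau η (fun u => L (u, z.2)) z.1

noncomputable def hessForm {n m : ℕ} (L : Eu n × Eu m → ℝ) (z v w : Eu n × Eu m) : ℝ :=
  ⟪(Hxx L z) v.1, w.1⟫ + ⟪(Hxy L z) v.2, w.1⟫ + ⟪(Hyx L z) v.1, w.2⟫ + ⟪(Hyy L z) v.2, w.2⟫

theorem sq_norm_sub_le_of_cocoercive {V : Type*} [NormedAddCommGroup V] [InnerProductSpace ℝ V]
    {ρ η : ℝ} (hρ : 0 < ρ) (hη : ρ < η) {p u : V} (h : (η - ρ) * ‖p‖ ^ 2 ≤ η * ⟪p, u⟫) :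
    ‖u - p‖ ^ 2 ≤ ‖u‖ ^ 2 / min 1 ((η / ρ - 1) ^ 2) := by
  obtain ⟨τ, hτ⟩ : ∃ τ, τ = η / ρ - 1 := ⟨_, rfl⟩
  have hητ : η = ρ * (1 + τ) := by rw [hτ]; field_simp; ring
  have hτ0 : 0 < τ := by
    rw [hτ, sub_pos, lt_div_iff₀ hρ]; linarith
  rw [← hτ, le_div_iff₀ (by positivity)]
  obtain ⟨q, rfl⟩ : ∃ q, u = p + q := ⟨u - p, by abel⟩
  rw [add_sub_cancel_left, norm_add_sq_real]
  have hi : -‖p‖ ^ 2 ≤ (1 + τ) * ⟪p, q⟫ := by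
    rw [inner_add_right, real_inner_self_eq_norm_sq, hητ] at h
    have : ρ * (-‖p‖ ^ 2) ≤ ρ * ((1 + τ) * ⟪p, q⟫) := by linarith
    exact le_of_mul_le_mul_left this hρ
  have hcs : ⟪p, q⟫ ^ 2 ≤ ‖p‖ ^ 2 * ‖q‖ ^ 2 := by
    rw [← mul_pow]
    exact sq_le_sq' (by linarith [neg_le_of_abs_le (abs_real_inner_le_norm p q)])
      (real_inner_le_norm p q)
  generalize ⟪p, q⟫ = i at *
  have hP : 0 ≤ ‖p‖ ^ 2 := by positivity
  have hQ : 0 ≤ ‖q‖ ^ 2 := by positivity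
  generalize ‖p‖ ^ 2 = P at *
  generalize ‖q‖ ^ 2 = Q at *
  by_cases hi0 : 0 ≤ i
  · nlinarith [min_le_left 1 (τ ^ 2)]
  push Not at hi0
  rcases le_total 1 τ with h1 | h1
  · have : min 1 (τ ^ 2) ≤ 1 := min_le_left _ _
    nlinarith
  · have hm : min 1 (τ ^ 2) ≤ τ ^ 2 := min_le_right _ _
    have hP0 : 0 < P := by nlinarith
    have key : 0 ≤ P * ((1 - τ ^ 2) * Q + P + 2 * i) := by
      have h2 : 0 ≤ (P + i - τ * i) * (P + i + τ * i) :=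
        mul_nonneg (by nlinarith) (by nlinarith)
      have h3 : (1 - τ ^ 2) * i ^ 2 ≤ (1 - τ ^ 2) * (P * Q) :=
        mul_le_mul_of_nonneg_left hcs (by nlinarith)
      nlinarith
    have := nonneg_of_mul_nonneg_right key hP0
    nlinarith

theorem sq_norm_relaxed_step_le {V : Type*} [NormedAddCommGroup V] [InnerProductSpace ℝ V]
    {ρ η θ s : ℝ} (hρ : 0 < ρ) (hη : ρ < η) (hs : 0 ≤ s) {p u : V}
    (h : (η - ρ) * ‖p‖ ^ 2 ≤ η * ⟪p, u⟫) (hθ : ⟪p, u⟫ ≤ (1 - θ) * ‖u‖ ^ 2) :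
    ‖u - s • (u - p)‖ ^ 2 ≤
      (1 - 2 * s * θ + s ^ 2 / min 1 ((η / ρ - 1) ^ 2)) * ‖u‖ ^ 2 := by
  have h1 := sq_norm_sub_le_of_cocoercive hρ hη h
  rw [norm_sub_sq_real, inner_smul_right, norm_smul, mul_pow, Real.norm_eq_abs, sq_abs,
    inner_sub_right, real_inner_self_eq_norm_sq, real_inner_comm]
  have h2 := mul_le_mul_of_nonneg_left h1 (sq_nonneg s)
  have h3 := mul_le_mul_of_nonneg_left hθ hs
  have h4 : s ^ 2 * (‖u‖ ^ 2 / min 1 ((η / ρ - 1) ^ 2)) =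
    s ^ 2 / min 1 ((η / ρ - 1) ^ 2) * ‖u‖ ^ 2 := by ring
  nlinarith

theorem exists_fixedPoint_of_locally_strongly_monotone {V : Type*} [NormedAddCommGroup V]
    [InnerProductSpace ℝ V] [CompleteSpace V]
    {ρ η θ R : ℝ} (hρ : 0 < ρ) (hη : ρ < η) (hθ0 : 0 < θ) (hθ1 : θ < 1) (hR : 0 ≤ R)
    {P : V → V} {z₀ : V}
    (hmono : ∀ a b, (η - ρ) * ‖P a - P b‖ ^ 2 ≤ η * ⟪P a - P b, a - b⟫)
    (hloc : ∀ a b, ‖a - z₀‖ ≤ R → ‖b - z₀‖ ≤ R →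
      ⟪P a - P b, a - b⟫ ≤ (1 - θ) * ‖a - b‖ ^ 2)
    (hN : ‖z₀ - P z₀‖ ≤ θ * R / 2) :
    ∃ zs, P zs = zs ∧ ‖zs - z₀‖ ≤ R / 2 := by
  set M := min 1 ((η / ρ - 1) ^ 2) with hM
  have hM0 : 0 < M := by
    have : 0 < η / ρ - 1 := by rw [sub_pos, lt_div_iff₀ hρ]; linarith
    positivity
  have hM1 : M ≤ 1 := min_le_left _ _
  set s := θ * M with hs
  have hs0 : 0 < s := by positivity
  set T : V → V := fun a => a - s • (a - P a) with hT
  set c := Real.sqrt (1 - θ * s) with hc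
  have hθs : 0 < θ * s := by positivity
  have hθs1 : θ * s < 1 := by
    have : s ≤ 1 := by nlinarith
    nlinarith
  have hc0 : 0 ≤ c := Real.sqrt_nonneg _
  have hc2 : c ^ 2 = 1 - θ * s := Real.sq_sqrt (by linarith)
  have hc1 : c < 1 := by nlinarith
  have hlip : ∀ a b, ‖a - z₀‖ ≤ R → ‖b - z₀‖ ≤ R → ‖T a - T b‖ ≤ c * ‖a - b‖ := by
    intro a b ha hb
    have h1 := sq_norm_relaxed_step_le hρ hη hs0.le (hmono a b) (hloc a b ha hb)
    have h2 : T a - T b = (a - b) - s • ((a - b) - (P a - P b)) := by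
      simp only [hT, smul_sub]; abel
    rw [h2]
    refine abs_le_of_sq_le_sq' ?_ (by positivity) |>.2
    rw [mul_pow, hc2]
    refine h1.trans_eq ?_
    rw [← hM]
    have : s ^ 2 / M = θ * s := by rw [hs]; field_simp
    rw [this]; ring
  have hmaps : Set.MapsTo T (closedBall z₀ R) (closedBall z₀ R) := by
    intro a ha
    rw [mem_closedBall, dist_eq_norm] at ha ⊢
    have h1 := hlip a z₀ ha (by simpa using hR)
    have h2 : T a - z₀ = (T a - T z₀) - s • (z₀ - P z₀) := by
      simp only [hT]; abel
    have h3 : ‖T a - z₀‖ ≤ c * ‖a - z₀‖ + s * ‖z₀ - P z₀‖ := by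
      rw [h2]
      refine (norm_sub_le _ _).trans ?_
      rw [norm_smul, Real.norm_of_nonneg hs0.le]
      linarith
    have h4 := mul_le_mul_of_nonneg_left ha hc0
    have h5 := mul_le_mul_of_nonneg_left hN hs0.le
    have h6 : θ * s / 2 ≤ 1 - c := by nlinarith
    have h7 := mul_le_mul_of_nonneg_right h6 hR
    nlinarith
  have hcontr : ContractingWith ⟨c, hc0⟩ (hmaps.restrict T _ _) := by
    refine ⟨by exact_mod_cast hc1, LipschitzWith.of_dist_le_mul fun a b => ?_⟩
    have ha := a.2
    have hb := b.2
    rw [mem_closedBall, dist_eq_norm] at ha hb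
    rw [Subtype.dist_eq, Subtype.dist_eq, dist_eq_norm, dist_eq_norm]
    exact hlip a b ha hb
  obtain ⟨zs, hzs, hfix, -⟩ := hcontr.exists_fixedPoint' isClosed_closedBall.isComplete hmaps
    (mem_closedBall_self hR) (edist_ne_top _ _)
  rw [mem_closedBall, dist_eq_norm] at hzs
  have hPzs : P zs = zs := by
    have h1 : zs - s • (zs - P zs) = zs := hfix
    have h2 : s • (zs - P zs) = 0 := by simpa using h1
    exact ((sub_eq_zero.1 ((smul_eq_zero.1 h2).resolve_left hs0.ne'))).symm
  refine ⟨zs, hPzs, ?_⟩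
  have h1 := hloc zs z₀ hzs (by simpa using hR)
  rw [hPzs] at h1
  have h2 : ⟪zs - P z₀, zs - z₀⟫ = ‖zs - z₀‖ ^ 2 + ⟪z₀ - P z₀, zs - z₀⟫ := by
    rw [← real_inner_self_eq_norm_sq, ← inner_add_left]; congr 1; abel
  have h3 := neg_le_of_abs_le (abs_real_inner_le_norm (z₀ - P z₀) (zs - z₀))
  have h4 := mul_le_mul_of_nonneg_right hN (norm_nonneg (zs - z₀))
  by_contra! h5
  have h6 : 0 < ‖zs - z₀‖ := by linarith
  nlinarith [mul_pos hθ0 h6, mul_pos (mul_pos hθ0 h6) (sub_pos.2 h5)]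

theorem relaxed_iterates_contract {V : Type*} [NormedAddCommGroup V]
    [InnerProductSpace ℝ V]
    {ρ η θ θ' R lam : ℝ} (hρ : 0 < ρ) (hη : ρ < η) (hθ : θ < θ')
    (hθ1 : θ ≤ 1) (hlam0 : 0 < lam)
    (hlam : 2 * lam * θ ≥ lam ^ 2 / min 1 ((η / ρ - 1) ^ 2))
    {P : V → V} {z₀ zs : V} (hfix : P zs = zs) (hzs : ‖zs - z₀‖ ≤ R / 2)
    (hmono : ∀ a b, (η - ρ) * ‖P a - P b‖ ^ 2 ≤ η * ⟪P a - P b, a - b⟫)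
    (hloc : ∀ a b, ‖a - z₀‖ ≤ R → ‖b - z₀‖ ≤ R →
      ⟪P a - P b, a - b⟫ ≤ (1 - θ') * ‖a - b‖ ^ 2)
    {z : ℕ → V} (hz0 : z 0 = z₀) (hz : ∀ k, z (k + 1) = (1 - lam) • z k + lam • P (z k)) :
    (∀ k, ‖z k - zs‖ ^ 2 ≤
      (1 - 2 * lam * θ + lam ^ 2 / min 1 ((η / ρ - 1) ^ 2)) ^ k * ‖z₀ - zs‖ ^ 2) ∧
    Tendsto z atTop (𝓝 zs) := by
  set M := min 1 ((η / ρ - 1) ^ 2) with hM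
  have hM0 : 0 < M := by
    have : 0 < η / ρ - 1 := by rw [sub_pos, lt_div_iff₀ hρ]; linarith
    positivity
  have hM1 : M ≤ 1 := min_le_left _ _
  have hlM : lam ^ 2 ≤ lam ^ 2 / M := by
    rw [le_div_iff₀ hM0]; nlinarith [sq_nonneg lam]
  set c := 1 - 2 * lam * θ + lam ^ 2 / M with hc
  set c' := max 0 (1 - 2 * lam * θ' + lam ^ 2 / M) with hc'
  have hlt : lam * θ < lam * θ' := mul_lt_mul_of_pos_left hθ hlam0
  have hc0 : 0 ≤ c := by nlinarith [sq_nonneg (1 - lam)]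
  have hc'0 : 0 ≤ c' := le_max_left _ _
  have hc'1 : c' < 1 := max_lt one_pos (by linarith)
  have hc'c : c' ≤ c := max_le hc0 (by linarith)
  have hR : 0 ≤ R := by linarith [norm_nonneg (zs - z₀)]
  have hstep : ∀ k, ‖z k - z₀‖ ≤ R → ‖z (k + 1) - zs‖ ^ 2 ≤ c' * ‖z k - zs‖ ^ 2 := by
    intro k hk
    have h1 := sq_norm_relaxed_step_le hρ hη hlam0.le (hmono (z k) zs)
      (hloc (z k) zs hk (by linarith))
    have h2 : z (k + 1) - zs = (z k - zs) - lam • ((z k - zs) - (P (z k) - P zs)) := by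
      rw [hz, hfix]; module
    rw [h2]
    exact h1.trans (mul_le_mul_of_nonneg_right (le_max_right _ _) (by positivity))
  have hall : ∀ k, ‖z k - zs‖ ^ 2 ≤ c' ^ k * ‖z₀ - zs‖ ^ 2 := by
    intro k
    induction k with
    | zero => simp [hz0]
    | succ k ih =>
      have h1 : ‖z k - zs‖ ≤ ‖z₀ - zs‖ := by
        refine abs_le_of_sq_le_sq' (ih.trans ?_) (by positivity) |>.2
        exact mul_le_of_le_one_left (by positivity) (pow_le_one₀ hc'0 hc'1.le)
      have h2 : ‖z k - z₀‖ ≤ R := by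
        have := norm_sub_le_norm_sub_add_norm_sub (z k) zs z₀
        rw [norm_sub_rev z₀ zs] at h1
        linarith
      calc _ ≤ c' * ‖z k - zs‖ ^ 2 := hstep k h2
        _ ≤ c' * (c' ^ k * ‖z₀ - zs‖ ^ 2) := mul_le_mul_of_nonneg_left ih hc'0
        _ = _ := by ring
  refine ⟨fun k => (hall k).trans
    (mul_le_mul_of_nonneg_right (pow_le_pow_left₀ hc'0 hc'c k) (by positivity)), ?_⟩
  rw [tendsto_iff_norm_sub_tendsto_zero]
  have h1 : Tendsto (fun k => c' ^ k * ‖z₀ - zs‖ ^ 2) atTop (𝓝 0) := by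
    simpa using (tendsto_pow_atTop_nhds_zero_of_lt_one hc'0 hc'1).mul_const (‖z₀ - zs‖ ^ 2)
  have h2 := (squeeze_zero (fun k => by positivity) hall h1).sqrt
  simpa using h2

theorem inner_le_of_sq_le_inner {V : Type*} [NormedAddCommGroup V] [InnerProductSpace ℝ V]
    {η α : ℝ} (hη : 0 < η) (hα : 0 < α) {a v : V} (h : (η + α) * ‖a‖ ^ 2 ≤ η * ⟪v, a⟫) :
    ⟪a, v⟫ ≤ η / (η + α) * ‖v‖ ^ 2 := by
  have h1 := real_inner_le_norm v a
  rw [real_inner_comm]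
  have h2 : (η + α) * ‖a‖ ≤ η * ‖v‖ := by
    rcases (norm_nonneg a).eq_or_lt with h0 | h0
    · rw [← h0]; simp; positivity
    · refine le_of_mul_le_mul_right ?_ h0
      nlinarith
  rw [div_mul_eq_mul_div, le_div_iff₀ (by positivity)]
  nlinarith [norm_nonneg v, mul_le_mul_of_nonneg_right h2 (norm_nonneg v)]

theorem inner_le_of_dominance {V W : Type*} [NormedAddCommGroup V] [InnerProductSpace ℝ V]
    [FiniteDimensional ℝ V] [NormedAddCommGroup W] [InnerProductSpace ℝ W]
    [FiniteDimensional ℝ W] {ρ η α : ℝ} (hρ : 0 < ρ) (hη : ρ < η) (hα : 0 < α)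
    (Q : V × W →L[ℝ] V × W →L[ℝ] ℝ) (hsymm : ∀ v w, Q v w = Q w v)
    (hx : ∀ v : V, -ρ * ‖v‖ ^ 2 ≤ Q (v, 0) (v, 0)) (hy : ∀ w : W, Q (0, w) (0, w) ≤ ρ * ‖w‖ ^ 2)
    (hdx : ∀ a : V, ∃ b : W, α * ‖a‖ ^ 2 ≤ Q (a, b) (a, b) - η * ‖b‖ ^ 2)
    (hdy : ∀ b : W, ∃ a : V, α * ‖b‖ ^ 2 ≤ -Q (a, b) (a, b) - η * ‖a‖ ^ 2)
    {p u : V × W} (hp : ∀ v w, Q p (v, w) = η * ⟪u.1 - p.1, v⟫ - η * ⟪u.2 - p.2, w⟫) :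
    ⟪p.1, u.1⟫ + ⟪p.2, u.2⟫ ≤ η / (η + α) * (‖u.1‖ ^ 2 + ‖u.2‖ ^ 2) := by
  have hη0 : 0 < η := hρ.trans hη
  let M : V × W →ₗ[ℝ] Module.Dual ℝ (V × W) := LinearMap.mk₂ ℝ
    (fun p q => Q p q + η * ⟪p.1, q.1⟫ - η * ⟪p.2, q.2⟫)
    (by intros; simp [inner_add_left]; ring) (by intros; simp [inner_smul_left]; ring)
    (by intros; simp [inner_add_right]; ring) (by intros; simp [inner_smul_right]; ring)
  have hM : ∀ p q, M p q = Q p q + η * ⟪p.1, q.1⟫ - η * ⟪p.2, q.2⟫ := fun _ _ => rfl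
  have hMsymm : ∀ p q, M p q = M q p := fun p q => by
    rw [hM, hM, hsymm, real_inner_comm, real_inner_comm q.2]
  have hMinj : Function.Injective M := by
    rw [← LinearMap.ker_eq_bot, LinearMap.ker_eq_bot']
    intro q hq
    have h1 : M q (q.1, 0) = 0 := by rw [hq]; rfl
    have h2 : M q (0, q.2) = 0 := by rw [hq]; rfl
    have hq' : ∀ x, M q x = M (q.1, 0) x + M (0, q.2) x := fun x => by
      rw [← LinearMap.add_apply, ← map_add]; simp
    have h3 := hq' (q.1, 0)
    have h4 := hq' (0, q.2)
    rw [hMsymm (q.1, 0)] at h4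
    have h5 : M (q.1, 0) (q.1, 0) = Q (q.1, 0) (q.1, 0) + η * ‖q.1‖ ^ 2 := by
      simp [hM]
    have h6 : M (0, q.2) (0, q.2) = Q (0, q.2) (0, q.2) - η * ‖q.2‖ ^ 2 := by
      simp [hM]
    have h7 := hx q.1
    have h8 := hy q.2
    have h9 : (η - ρ) * (‖q.1‖ ^ 2 + ‖q.2‖ ^ 2) ≤ 0 := by linarith
    have h10 : ‖q.1‖ ^ 2 + ‖q.2‖ ^ 2 ≤ 0 := by
      by_contra! h
      nlinarith [mul_pos (sub_pos.2 hη) h]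
    have h11 : ‖q.1‖ ^ 2 = 0 := by nlinarith [sq_nonneg ‖q.1‖, sq_nonneg ‖q.2‖]
    have h12 : ‖q.2‖ ^ 2 = 0 := by nlinarith [sq_nonneg ‖q.1‖, sq_nonneg ‖q.2‖]
    exact Prod.ext (by simpa using h11) (by simpa using h12)
  have hMsurj : Function.Surjective M :=
    (LinearMap.injective_iff_surjective_of_finrank_eq_finrank
      Subspace.dual_finrank_eq.symm).1 hMinj
  obtain ⟨p', hp'⟩ := hMsurj ((η • (innerₛₗ ℝ u.1)) ∘ₗ LinearMap.fst ℝ V W)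
  have hp' : ∀ q, M p' q = η * ⟪u.1, q.1⟫ := fun q => by rw [hp']; rfl
  have hMp : ∀ q, M p q = η * ⟪u.1, q.1⟫ - η * ⟪u.2, q.2⟫ := by
    intro q
    rw [hM, ← Prod.mk.eta (p := q), hp, inner_sub_left, inner_sub_left]; ring
  obtain ⟨p'', rfl⟩ : ∃ p'', p = p' + p'' := ⟨p - p', by abel⟩
  have hp'' : ∀ q, M p'' q = - (η * ⟪u.2, q.2⟫) := fun q => by
    have := hMp q
    rw [map_add, LinearMap.add_apply, hp'] at this
    linarith
  have hcross : ⟪p''.1, u.1⟫ + ⟪p'.2, u.2⟫ = 0 := by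
    have h1 := hp' p''
    rw [hMsymm, hp''] at h1
    have : η * (⟪p''.1, u.1⟫ + ⟪p'.2, u.2⟫) = 0 := by
      rw [real_inner_comm, real_inner_comm u.2]; linarith
    exact (mul_eq_zero.1 this).resolve_left hη0.ne'
  have hA : ⟪p'.1, u.1⟫ ≤ η / (η + α) * ‖u.1‖ ^ 2 := by
    apply inner_le_of_sq_le_inner hη0 hα
    obtain ⟨b, hb⟩ := hdx p'.1
    rw [← hp']
    have e : (p'.1, b) = p' + (0, b - p'.2) := Prod.ext (by simp) (by simp)
    have h1 : M (p'.1, b) (p'.1, b) = M p' p' + M (0, b - p'.2) (0, b - p'.2) := by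
      have h0 : M p' (0, b - p'.2) = 0 := by rw [hp', inner_zero_right, mul_zero]
      rw [e, map_add M, LinearMap.add_apply, map_add, map_add, hMsymm (0, b - p'.2) p', h0]
      ring
    have h2 : M (0, b - p'.2) (0, b - p'.2) ≤ 0 := by
      have := hy (b - p'.2)
      simp only [hM, inner_zero_left, real_inner_self_eq_norm_sq]
      nlinarith [sq_nonneg ‖b - p'.2‖]
    have h3 : M (p'.1, b) (p'.1, b) = Q (p'.1, b) (p'.1, b) + η * ‖p'.1‖ ^ 2 - η * ‖b‖ ^ 2 := by
      simp [hM]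
    linarith
  have hB : ⟪p''.2, u.2⟫ ≤ η / (η + α) * ‖u.2‖ ^ 2 := by
    apply inner_le_of_sq_le_inner hη0 hα
    obtain ⟨a, ha⟩ := hdy p''.2
    rw [← neg_neg (η * _), ← hp'']
    have e : (a, p''.2) = p'' + (a - p''.1, 0) := Prod.ext (by simp) (by simp)
    have h1 : M (a, p''.2) (a, p''.2) = M p'' p'' + M (a - p''.1, 0) (a - p''.1, 0) := by
      have h0 : M p'' (a - p''.1, 0) = 0 := by rw [hp'', inner_zero_right, mul_zero, neg_zero]
      rw [e, map_add M, LinearMap.add_apply, map_add, map_add, hMsymm (a - p''.1, 0) p'', h0]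
      ring
    have h2 : 0 ≤ M (a - p''.1, 0) (a - p''.1, 0) := by
      have := hx (a - p''.1)
      simp only [hM, inner_zero_left, real_inner_self_eq_norm_sq]
      nlinarith [sq_nonneg ‖a - p''.1‖]
    have h3 : M (a, p''.2) (a, p''.2) = Q (a, p''.2) (a, p''.2) + η * ‖a‖ ^ 2
        - η * ‖p''.2‖ ^ 2 := by
      simp [hM]
    linarith
  simp only [Prod.fst_add, Prod.snd_add, inner_add_left]
  linarith

theorem inner_fderiv_eq_of_inner_eq {V X E : Type*} [NormedAddCommGroup V]
    [InnerProductSpace ℝ V] [FiniteDimensional ℝ V] [NormedAddCommGroup X] [NormedSpace ℝ X]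
    [NormedAddCommGroup E] [NormedSpace ℝ E] {L : E → ℝ} (hL : ContDiff ℝ 2 L)
    {f : X → V} {c : X → E} {c' : X →L[ℝ] E} {x : X} (hc : HasFDerivAt c c' x) (i : V →L[ℝ] E)
    (hf : ∀ x v, ⟪f x, v⟫ = fderiv ℝ L (c x) (i v)) (v : X) (v' : V) :
    ⟪fderiv ℝ f x v, v'⟫ = fderiv ℝ (fderiv ℝ L) (c x) (c' v) (i v') := by
  let J : (V →L[ℝ] ℝ) →L[ℝ] V := LinearMap.toContinuousLinearMap
    { toFun := (InnerProductSpace.toDual ℝ V).symm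
      map_add' := map_add _
      map_smul' := fun r φ => by simp }
  have hJ : ∀ φ w, ⟪J φ, w⟫ = φ w := fun φ w => InnerProductSpace.toDual_symm_apply
  have hfJ : f = fun x => J (((ContinuousLinearMap.compL ℝ V E ℝ).flip i) (fderiv ℝ L (c x))) := by
    funext x
    refine ext_inner_right ℝ fun w => ?_
    rw [hJ, hf]; rfl
  have hD : DifferentiableAt ℝ (fderiv ℝ L) (c x) :=
    ((hL.fderiv_right (m := 1) (by norm_num)).differentiable (by norm_num)).differentiableAt
  have h1 : HasFDerivAt f (J ∘L ((ContinuousLinearMap.compL ℝ V E ℝ).flip i) ∘L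
      (fderiv ℝ (fderiv ℝ L) (c x)) ∘L c') x := by
    rw [hfJ]
    exact (J.hasFDerivAt.comp x (((ContinuousLinearMap.compL ℝ V E ℝ).flip i).hasFDerivAt.comp x
      (hD.hasFDerivAt.comp x hc)))
  rw [h1.fderiv]
  simp only [ContinuousLinearMap.comp_apply, hJ]
  rfl

section Blocks

variable {n m : ℕ} {L : Eu n × Eu m → ℝ}

theorem inner_gradient_fst (hL : ContDiff ℝ 2 L) (x : Eu n) (y : Eu m) (v : Eu n) :
    ⟪gradient (fun u => L (u, y)) x, v⟫ = fderiv ℝ L (x, y) (v, 0) := by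
  have h : HasFDerivAt (fun u => L (u, y)) (fderiv ℝ L (x, y) ∘L .inl ℝ _ _) x :=
    ((hL.differentiable (by norm_num)).differentiableAt.hasFDerivAt (x := (x, y))).comp x
      (hasFDerivAt_prodMk_left x y)
  rw [gradient, InnerProductSpace.toDual_symm_apply, h.fderiv]
  rfl

theorem inner_gradient_snd (hL : ContDiff ℝ 2 L) (x : Eu n) (y : Eu m) (w : Eu m) :
    ⟪gradient (fun v => L (x, v)) y, w⟫ = fderiv ℝ L (x, y) (0, w) := by
  have h : HasFDerivAt (fun v => L (x, v)) (fderiv ℝ L (x, y) ∘L .inr ℝ _ _) y :=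
    ((hL.differentiable (by norm_num)).differentiableAt.hasFDerivAt (x := (x, y))).comp y
      (hasFDerivAt_prodMk_right x y)
  rw [gradient, InnerProductSpace.toDual_symm_apply, h.fderiv]
  rfl

theorem inner_Hxx (hL : ContDiff ℝ 2 L) (z : Eu n × Eu m) (v v' : Eu n) :
    ⟪Hxx L z v, v'⟫ = fderiv ℝ (fderiv ℝ L) z (v, 0) (v', 0) :=
  inner_fderiv_eq_of_inner_eq hL (hasFDerivAt_prodMk_left z.1 z.2) (.inl ℝ _ _)
    (fun x v => inner_gradient_fst hL x z.2 v) v v'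

theorem inner_Hxy (hL : ContDiff ℝ 2 L) (z : Eu n × Eu m) (w : Eu m) (v : Eu n) :
    ⟪Hxy L z w, v⟫ = fderiv ℝ (fderiv ℝ L) z (0, w) (v, 0) :=
  inner_fderiv_eq_of_inner_eq hL (hasFDerivAt_prodMk_right z.1 z.2) (.inl ℝ _ _)
    (fun y v => inner_gradient_fst hL z.1 y v) w v

theorem inner_Hyx (hL : ContDiff ℝ 2 L) (z : Eu n × Eu m) (v : Eu n) (w : Eu m) :
    ⟪Hyx L z v, w⟫ = fderiv ℝ (fderiv ℝ L) z (v, 0) (0, w) :=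
  inner_fderiv_eq_of_inner_eq hL (hasFDerivAt_prodMk_left z.1 z.2) (.inr ℝ _ _)
    (fun x w => inner_gradient_snd hL x z.2 w) v w

theorem inner_Hyy (hL : ContDiff ℝ 2 L) (z : Eu n × Eu m) (w w' : Eu m) :
    ⟪Hyy L z w, w'⟫ = fderiv ℝ (fderiv ℝ L) z (0, w) (0, w') :=
  inner_fderiv_eq_of_inner_eq hL (hasFDerivAt_prodMk_right z.1 z.2) (.inr ℝ _ _)
    (fun y w => inner_gradient_snd hL z.1 y w) w w'

theorem hessForm_eq (hL : ContDiff ℝ 2 L) (z v w : Eu n × Eu m) :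
    hessForm L z v w = fderiv ℝ (fderiv ℝ L) z v w := by
  have hv : v = (v.1, 0) + (0, v.2) := Prod.ext (by simp) (by simp)
  have hw : w = (w.1, 0) + (0, w.2) := Prod.ext (by simp) (by simp)
  rw [hessForm, inner_Hxx hL, inner_Hxy hL, inner_Hyx hL, inner_Hyy hL]
  conv_rhs => rw [hv, hw]
  simp only [map_add, add_apply]
  ring

theorem fderiv_fderiv_symm (hL : ContDiff ℝ 2 L) (z v w : Eu n × Eu m) :
    fderiv ℝ (fderiv ℝ L) z v w = fderiv ℝ (fderiv ℝ L) z w v :=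
  (hL.contDiffAt.isSymmSndFDerivAt (by simp)) v w

end Blocks

theorem exists_average_fderiv {E F : Type*} [NormedAddCommGroup E] [NormedSpace ℝ E]
    [NormedAddCommGroup F] [NormedSpace ℝ F] [CompleteSpace F] {G : E → F}
    (hG : ContDiff ℝ 1 G) (a b : E) :
    ∃ Q : E →L[ℝ] F, G a - G b = Q (a - b) ∧
      ∀ v, Q v = ∫ t in (0 : ℝ)..1, fderiv ℝ G (b + t • (a - b)) v := by
  have hcont : Continuous fun t : ℝ => fderiv ℝ G (b + t • (a - b)) :=
    (hG.continuous_fderiv (by norm_num)).comp (by fun_prop)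
  refine ⟨∫ t in (0 : ℝ)..1, fderiv ℝ G (b + t • (a - b)), ?_, fun v =>
    ContinuousLinearMap.intervalIntegral_apply (hcont.intervalIntegrable _ _) v⟩
  rw [ContinuousLinearMap.intervalIntegral_apply (hcont.intervalIntegrable _ _)]
  have hderiv : ∀ t ∈ Set.uIcc (0 : ℝ) 1, HasDerivAt (fun t : ℝ => G (b + t • (a - b)))
      (fderiv ℝ G (b + t • (a - b)) (a - b)) t := by
    intro t _
    have h1 : HasDerivAt (fun t : ℝ => b + t • (a - b)) (a - b) t := by
      simpa using ((hasDerivAt_id t).smul_const (a - b)).const_add b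
    exact ((hG.differentiable (by norm_num)).differentiableAt.hasFDerivAt).comp_hasDerivAt t h1
  rw [intervalIntegral.integral_eq_sub_of_hasDerivAt hderiv
    ((hcont.clm_apply continuous_const).intervalIntegrable _ _)]
  simp

theorem exists_average_hessian {E : Type*} [NormedAddCommGroup E] [NormedSpace ℝ E]
    {L : E → ℝ} (hL : ContDiff ℝ 2 L) (a b : E) :
    ∃ Q : E →L[ℝ] E →L[ℝ] ℝ, fderiv ℝ L a - fderiv ℝ L b = Q (a - b) ∧
      (∀ v w, Q v w = Q w v) ∧
      (∀ v w C, (∀ t ∈ Set.Icc (0 : ℝ) 1,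
        fderiv ℝ (fderiv ℝ L) (b + t • (a - b)) v w ≤ C) → Q v w ≤ C) := by
  have hG : ContDiff ℝ 1 (fderiv ℝ L) := hL.fderiv_right (m := 1) (by norm_num)
  obtain ⟨Q, hQ, hint⟩ := exists_average_fderiv hG a b
  have hcont : Continuous fun t : ℝ => fderiv ℝ (fderiv ℝ L) (b + t • (a - b)) :=
    (hG.continuous_fderiv (by norm_num)).comp (by fun_prop)
  have hint' : ∀ v w, Q v w = ∫ t in (0 : ℝ)..1, fderiv ℝ (fderiv ℝ L) (b + t • (a - b)) v w := by
    intro v w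
    rw [hint, ContinuousLinearMap.intervalIntegral_apply
      ((hcont.clm_apply continuous_const).intervalIntegrable _ _)]
  refine ⟨Q, hQ, fun v w => ?_, fun v w C hC => ?_⟩
  · rw [hint', hint']
    congr 1
    funext t
    exact (hL.contDiffAt.isSymmSndFDerivAt (by simp)) v w
  · rw [hint']
    have h1 := intervalIntegral.integral_mono_on (μ := MeasureTheory.volume) zero_le_one
      (((hcont.clm_apply (continuous_const (y := v))).clm_apply
        (continuous_const (y := w))).intervalIntegrable 0 1)
      ((continuous_const (y := C)).intervalIntegrable 0 1) hC
    simpa using h1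

theorem isUnit_of_coercive {V : Type*} [NormedAddCommGroup V] [InnerProductSpace ℝ V]
    [FiniteDimensional ℝ V] {T : V →L[ℝ] V} {c : ℝ} (hc : 0 < c)
    (hT : ∀ b, c * ‖b‖ ^ 2 ≤ ⟪T b, b⟫) : IsUnit T := by
  have hinj : Function.Injective (T : V →ₗ[ℝ] V) := by
    rw [← LinearMap.ker_eq_bot, LinearMap.ker_eq_bot']
    intro b hb
    have h1 := hT b
    rw [show T b = 0 from hb, inner_zero_left] at h1
    have h2 : ‖b‖ ^ 2 ≤ 0 := by
      by_contra! h
      nlinarith [mul_pos hc h]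
    simpa using le_antisymm h2 (by positivity)
  rw [ContinuousLinearMap.isUnit_iff_bijective]
  exact ⟨hinj, LinearMap.injective_iff_surjective.1 hinj⟩

theorem exists_schur_partner {V W : Type*} [NormedAddCommGroup V] [InnerProductSpace ℝ V]
    [NormedAddCommGroup W] [InnerProductSpace ℝ W] [FiniteDimensional ℝ W]
    {T : W →L[ℝ] W} {B : W →L[ℝ] V} {B' : V →L[ℝ] W} {x : V} {c δ α : ℝ} (hc : 0 < c) (hδ0 : 0 ≤ δ)
    (hT : ∀ b, c * ‖b‖ ^ 2 ≤ ⟪T b, b⟫) (hB : ∀ w v, ⟪B w, v⟫ = ⟪B' v, w⟫)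
    (hδ : ∀ w v, ⟪B w, v⟫ ≤ δ * ‖w‖ * ‖v‖) {a : V}
    (h : α * ‖a‖ ^ 2 ≤ ⟪x + B (Ring.inverse T (B' a)), a⟫) :
    ∃ b, c * ‖b‖ ≤ δ * ‖a‖ ∧ α * ‖a‖ ^ 2 ≤ ⟪x, a⟫ + 2 * ⟪B b, a⟫ - ⟪T b, b⟫ := by
  have hu := isUnit_of_coercive hc hT
  refine ⟨Ring.inverse T (B' a), ?_, ?_⟩
  all_goals
    set b := Ring.inverse T (B' a) with hb
    have hTb : T b = B' a := by
      rw [hb, ← mul_apply_eq_comp, Ring.mul_inverse_cancel _ hu]; rfl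
    have h1 : ⟪T b, b⟫ = ⟪B b, a⟫ := by rw [hTb, hB]
  · have h2 := hT b
    have h3 := hδ b a
    rcases (norm_nonneg b).eq_or_lt with h0 | h0
    · rw [← h0, mul_zero]
      positivity
    · refine le_of_mul_le_mul_right ?_ h0
      nlinarith
  · rw [inner_add_left] at h
    linarith

theorem apply_flip_of_symm {V W : Type*} [NormedAddCommGroup V] [NormedSpace ℝ V]
    [NormedAddCommGroup W] [NormedSpace ℝ W] {Q : V × W →L[ℝ] V × W →L[ℝ] ℝ}
    (hQ : ∀ v w, Q v w = Q w v) (p : V × W) :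
    Q p (p.1, -p.2) = Q (p.1, 0) (p.1, 0) - Q (0, p.2) (0, p.2) := by
  have h1 : Q p = Q (p.1, 0) + Q (0, p.2) := by rw [← map_add]; simp
  have h2 : (p.1, -p.2) = (p.1, (0 : W)) - ((0 : V), p.2) := by simp
  rw [h2, map_sub, h1, add_apply, add_apply, hQ (0, p.2) (p.1, 0)]
  ring

theorem IsProxPoint.fderiv_eq {n m : ℕ} {L : Eu n × Eu m → ℝ} (hL : ContDiff ℝ 2 L) {η : ℝ}
    {z w : Eu n × Eu m} (h : IsProxPoint η L z w) (v : Eu n) (v' : Eu m) :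
    fderiv ℝ L w (v, v') = η * ⟪z.1 - w.1, v⟫ - η * ⟪z.2 - w.2, v'⟫ := by
  have hd : HasFDerivAt L (fderiv ℝ L w) (w.1, w.2) :=
    (hL.differentiable (by norm_num)).differentiableAt.hasFDerivAt
  have h1 : HasFDerivAt (fun u => proxObj η L z (u, w.2)) _ w.1 :=
    ((hd.comp w.1 (hasFDerivAt_prodMk_left w.1 w.2)).add
      (((hasFDerivAt_id w.1).sub_const z.1).norm_sq.const_mul (η / 2))).sub_const
        (η / 2 * ‖w.2 - z.2‖ ^ 2)
  have h2 : HasFDerivAt (fun u => proxObj η L z (w.1, u)) _ w.2 :=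
    ((hd.comp w.2 (hasFDerivAt_prodMk_right w.1 w.2)).add_const
      (η / 2 * ‖w.1 - z.1‖ ^ 2)).sub
      (((hasFDerivAt_id w.2).sub_const z.2).norm_sq.const_mul (η / 2))
  have h3 := IsLocalMin.hasFDerivAt_eq_zero
    (Filter.Eventually.of_forall fun u => h.2 u) h1
  have h4 := IsLocalMax.hasFDerivAt_eq_zero
    (Filter.Eventually.of_forall fun u => h.1 u) h2
  have h5 := congrArg (fun φ => φ v) h3
  have h6 := congrArg (fun φ => φ v') h4
  simp at h5 h6
  have h7 : fderiv ℝ L w (v, v') = fderiv ℝ L w (v, 0) + fderiv ℝ L w (0, v') := by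
    rw [← map_add]; simp
  rw [h7]
  simp only [inner_sub_left]
  linarith

theorem sqrt_eq_norm_toLp {V W : Type*} [NormedAddCommGroup V] [NormedAddCommGroup W]
    (v : V × W) :
    Real.sqrt (‖v.1‖ ^ 2 + ‖v.2‖ ^ 2) = ‖WithLp.toLp 2 v‖ :=
  (WithLp.prod_norm_eq_of_L2 (WithLp.toLp 2 v)).symm

theorem norm_toLp_sq {V W : Type*} [NormedAddCommGroup V] [NormedAddCommGroup W]
    (v : V × W) : ‖WithLp.toLp 2 v‖ ^ 2 = ‖v.1‖ ^ 2 + ‖v.2‖ ^ 2 :=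
  WithLp.prod_norm_sq_eq_of_L2 (WithLp.toLp 2 v)

theorem norm_toLp_flip {V W : Type*} [NormedAddCommGroup V] [NormedAddCommGroup W]
    (v : V × W) : ‖WithLp.toLp 2 (v.1, -v.2)‖ = ‖WithLp.toLp 2 v‖ := by
  rw [← sqrt_eq_norm_toLp, ← sqrt_eq_norm_toLp, norm_neg]

section L2

variable {V W : Type*} [NormedAddCommGroup V] [InnerProductSpace ℝ V]
    [NormedAddCommGroup W] [InnerProductSpace ℝ W]

theorem inner_toLp (v w : V × W) :
    ⟪WithLp.toLp 2 v, WithLp.toLp 2 w⟫ = ⟪v.1, w.1⟫ + ⟪v.2, w.2⟫ :=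
  WithLp.prod_inner_apply _ _

theorem norm_toLp_segment_sub_le {a b z : V × W} {r : ℝ} (ha : ‖WithLp.toLp 2 (a - z)‖ ≤ r)
    (hb : ‖WithLp.toLp 2 (b - z)‖ ≤ r) {t : ℝ} (ht : t ∈ Set.Icc (0 : ℝ) 1) :
    ‖WithLp.toLp 2 (b + t • (a - b) - z)‖ ≤ r := by
  have h : b + t • (a - b) - z = (1 - t) • (b - z) + t • (a - z) := by module
  rw [h, WithLp.toLp_add, WithLp.toLp_smul, WithLp.toLp_smul]
  refine (norm_add_le _ _).trans ?_
  rw [norm_smul, norm_smul, Real.norm_of_nonneg ht.1, Real.norm_of_nonneg (sub_nonneg.2 ht.2)]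
  nlinarith [ht.1, ht.2]

end L2

section Prox

variable {n m : ℕ} {L : Eu n × Eu m → ℝ} {ρ η : ℝ}

theorem exists_average_hessian_of_weak (hL : ContDiff ℝ 2 L) (hweak : WeaklyConvexConcave ρ L)
    (a b : Eu n × Eu m) :
    ∃ Q : Eu n × Eu m →L[ℝ] Eu n × Eu m →L[ℝ] ℝ, fderiv ℝ L a - fderiv ℝ L b = Q (a - b) ∧
      (∀ v w, Q v w = Q w v) ∧
      (∀ v, -ρ * ‖v‖ ^ 2 ≤ Q (v, 0) (v, 0)) ∧ (∀ w, Q (0, w) (0, w) ≤ ρ * ‖w‖ ^ 2) ∧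
      (∀ v w C, (∀ t ∈ Set.Icc (0 : ℝ) 1,
        fderiv ℝ (fderiv ℝ L) (b + t • (a - b)) v w ≤ C) → Q v w ≤ C) := by
  obtain ⟨Q, hQ, hsymm, hup⟩ := exists_average_hessian hL a b
  refine ⟨Q, hQ, hsymm, fun v => ?_, fun w => hup _ _ _ fun t _ => ?_, hup⟩
  · have := hup (-(v, 0)) (v, 0) (ρ * ‖v‖ ^ 2) fun t _ => by
      rw [map_neg, neg_apply, ← inner_Hxx hL]
      linarith [(hweak (b + t • (a - b))).1 v]
    rw [map_neg, neg_apply] at this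
    linarith
  · rw [← inner_Hyy hL]
    exact (hweak (b + t • (a - b))).2 w

theorem neg_le_apply_flip {Q : Eu n × Eu m →L[ℝ] Eu n × Eu m →L[ℝ] ℝ}
    (hsymm : ∀ v w, Q v w = Q w v) (hx : ∀ v, -ρ * ‖v‖ ^ 2 ≤ Q (v, 0) (v, 0))
    (hy : ∀ w, Q (0, w) (0, w) ≤ ρ * ‖w‖ ^ 2) (p : Eu n × Eu m) :
    -ρ * ‖WithLp.toLp 2 p‖ ^ 2 ≤ Q p (p.1, -p.2) := by
  rw [apply_flip_of_symm hsymm, norm_toLp_sq]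
  linarith [hx p.1, hy p.2]

theorem prox_cocoercive (hL : ContDiff ℝ 2 L) (hweak : WeaklyConvexConcave ρ L)
    {a b pa pb : Eu n × Eu m} (ha : IsProxPoint η L a pa) (hb : IsProxPoint η L b pb) :
    (η - ρ) * ‖WithLp.toLp 2 (pa - pb)‖ ^ 2 ≤
      η * ⟪WithLp.toLp 2 (pa - pb), WithLp.toLp 2 (a - b)⟫ := by
  obtain ⟨Q, hQ, hsymm, hx, hy, -⟩ := exists_average_hessian_of_weak hL hweak pa pb
  have h1 := neg_le_apply_flip hsymm hx hy (pa - pb)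
  rw [← hQ, sub_apply, ha.fderiv_eq hL, hb.fderiv_eq hL] at h1
  rw [norm_toLp_sq] at h1 ⊢
  rw [inner_toLp, real_inner_comm, real_inner_comm (a - b).2]
  simp only [← real_inner_self_eq_norm_sq] at h1 ⊢
  simp only [Prod.fst_sub, Prod.snd_sub, inner_sub_left, inner_sub_right, inner_neg_right] at h1 ⊢
  linarith

theorem fderiv_le_gradient_norm (hL : ContDiff ℝ 2 L) (z v : Eu n × Eu m) :
    fderiv ℝ L z v ≤ Real.sqrt (‖gradx L z‖ ^ 2 + ‖grady L z‖ ^ 2) * ‖WithLp.toLp 2 v‖ := by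
  have h1 : fderiv ℝ L z v = ⟪WithLp.toLp 2 (gradx L z, grady L z), WithLp.toLp 2 v⟫ := by
    have hv : v = (v.1, 0) + (0, v.2) := Prod.ext (by simp) (by simp)
    conv_lhs => rw [hv, map_add]
    rw [inner_toLp]
    exact congrArg₂ _ (inner_gradient_fst hL z.1 z.2 v.1).symm
      (inner_gradient_snd hL z.1 z.2 v.2).symm
  have h2 := sqrt_eq_norm_toLp (gradx L z, grady L z)
  rw [h1]
  refine (real_inner_le_norm _ _).trans_eq ?_
  rw [← h2]

theorem norm_prox_sub_le (hL : ContDiff ℝ 2 L) (hweak : WeaklyConvexConcave ρ L)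
    {z w : Eu n × Eu m} (h : IsProxPoint η L z w) :
    (η - ρ) * ‖WithLp.toLp 2 (w - z)‖ ≤ Real.sqrt (‖gradx L z‖ ^ 2 + ‖grady L z‖ ^ 2) ∧
    ∀ β, (∀ z v w : Eu n × Eu m, |hessForm L z v w| ≤
      β * Real.sqrt (‖v.1‖ ^ 2 + ‖v.2‖ ^ 2) * Real.sqrt (‖w.1‖ ^ 2 + ‖w.2‖ ^ 2)) →
      (η - β) * ‖WithLp.toLp 2 (w - z)‖ ≤ Real.sqrt (‖gradx L z‖ ^ 2 + ‖grady L z‖ ^ 2) := by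
  obtain ⟨Q, hQ, hsymm, hx, hy, hup⟩ := exists_average_hessian_of_weak hL hweak w z
  set p := w - z with hp
  have h1 := neg_le_apply_flip hsymm hx hy p
  have h2 : Q p (p.1, -p.2) = -η * ‖WithLp.toLp 2 p‖ ^ 2 - fderiv ℝ L z (p.1, -p.2) := by
    rw [← hQ, sub_apply, h.fderiv_eq hL, norm_toLp_sq, ← real_inner_self_eq_norm_sq,
      ← real_inner_self_eq_norm_sq]
    simp only [hp, Prod.fst_sub, Prod.snd_sub, inner_sub_left, inner_sub_right, inner_neg_right]
    ring
  have h3 := fderiv_le_gradient_norm hL z (-(p.1, -p.2))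
  rw [map_neg, WithLp.toLp_neg, norm_neg, norm_toLp_flip] at h3
  have key : ∀ c, -c * ‖WithLp.toLp 2 p‖ ^ 2 ≤ Q p (p.1, -p.2) → (η - c) * ‖WithLp.toLp 2 p‖ ≤
      Real.sqrt (‖gradx L z‖ ^ 2 + ‖grady L z‖ ^ 2) := by
    intro c hc
    rcases (norm_nonneg (WithLp.toLp 2 p)).eq_or_lt with h0 | h0
    · rw [← h0, mul_zero]
      positivity
    · refine le_of_mul_le_mul_right ?_ h0
      nlinarith
  refine ⟨key ρ h1, fun β hβ => key β ?_⟩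
  have h4 := hup (-p) (p.1, -p.2) (β * ‖WithLp.toLp 2 p‖ ^ 2) fun t _ => by
    have h5 := hβ (z + t • (w - z)) (-p) (p.1, -p.2)
    rw [sqrt_eq_norm_toLp, sqrt_eq_norm_toLp, norm_toLp_flip, WithLp.toLp_neg, norm_neg,
      hessForm_eq hL] at h5
    linarith [le_of_abs_le h5]
  rw [map_neg, neg_apply] at h4
  linarith

theorem sq_add_sq_le_of_mul_le {x y c δ : ℝ} (hy : 0 ≤ y) (hc : 0 < c) (h : c * y ≤ δ * x) :
    x ^ 2 + y ^ 2 ≤ (1 + (δ / c) ^ 2) * x ^ 2 := by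
  have h1 : y ≤ δ / c * x := by
    rw [div_mul_eq_mul_div, le_div_iff₀ hc]; linarith
  nlinarith [pow_le_pow_left₀ hy h1 2]

theorem prox_inner_le (hL : ContDiff ℝ 2 L) (hweak : WeaklyConvexConcave ρ L) (hρ : 0 < ρ)
    (hη : ρ < η) {H δ α₀ r : ℝ} (hH0 : 0 ≤ H) {z₀ : Eu n × Eu m}
    (hH : ∀ z zb v w : Eu n × Eu m, |hessForm L z v w - hessForm L zb v w| ≤
      H * Real.sqrt (‖z.1 - zb.1‖ ^ 2 + ‖z.2 - zb.2‖ ^ 2) *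
        Real.sqrt (‖v.1‖ ^ 2 + ‖v.2‖ ^ 2) * Real.sqrt (‖w.1‖ ^ 2 + ‖w.2‖ ^ 2))
    (hdx : ∀ a : Eu n, ∃ b : Eu m, (η - ρ) * ‖b‖ ≤ δ * ‖a‖ ∧
      α₀ * ‖a‖ ^ 2 ≤ fderiv ℝ (fderiv ℝ L) z₀ (a, b) (a, b) - η * ‖b‖ ^ 2)
    (hdy : ∀ b : Eu m, ∃ a : Eu n, (η - ρ) * ‖a‖ ≤ δ * ‖b‖ ∧
      α₀ * ‖b‖ ^ 2 ≤ -fderiv ℝ (fderiv ℝ L) z₀ (a, b) (a, b) - η * ‖a‖ ^ 2)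
    (hα : 0 < α₀ - H * r * (1 + (δ / (η - ρ)) ^ 2))
    {a b pa pb : Eu n × Eu m} (ha : IsProxPoint η L a pa) (hb : IsProxPoint η L b pb)
    (har : ‖WithLp.toLp 2 (pa - z₀)‖ ≤ r) (hbr : ‖WithLp.toLp 2 (pb - z₀)‖ ≤ r) :
    ⟪WithLp.toLp 2 (pa - pb), WithLp.toLp 2 (a - b)⟫ ≤
      η / (η + (α₀ - H * r * (1 + (δ / (η - ρ)) ^ 2))) * ‖WithLp.toLp 2 (a - b)‖ ^ 2 := by
  obtain ⟨Q, hQ, hsymm, hx, hy, hup⟩ := exists_average_hessian_of_weak hL hweak pa pb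
  have hηρ : 0 < η - ρ := sub_pos.2 hη
  have hr : 0 ≤ r := (norm_nonneg _).trans har
  have hHr : 0 ≤ H * r := by positivity
  have hdiff : ∀ v : Eu n × Eu m, ∀ t ∈ Set.Icc (0 : ℝ) 1,
      |fderiv ℝ (fderiv ℝ L) (pb + t • (pa - pb)) v v - fderiv ℝ (fderiv ℝ L) z₀ v v| ≤
        H * r * ‖WithLp.toLp 2 v‖ ^ 2 := by
    intro v t ht
    have h1 := hH (pb + t • (pa - pb)) z₀ v v
    have h2 : Real.sqrt (‖(pb + t • (pa - pb)).1 - z₀.1‖ ^ 2 +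
        ‖(pb + t • (pa - pb)).2 - z₀.2‖ ^ 2) ≤ r :=
      (sqrt_eq_norm_toLp (pb + t • (pa - pb) - z₀)).trans_le (norm_toLp_segment_sub_le har hbr ht)
    rw [hessForm_eq hL, hessForm_eq hL, sqrt_eq_norm_toLp v] at h1
    refine h1.trans ?_
    rw [mul_assoc, ← sq]
    gcongr
  have hQup : ∀ v, Q v v ≤ fderiv ℝ (fderiv ℝ L) z₀ v v + H * r * ‖WithLp.toLp 2 v‖ ^ 2 :=
    fun v => hup _ _ _ fun t ht => by linarith [le_of_abs_le (hdiff v t ht)]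
  have hQlow : ∀ v, fderiv ℝ (fderiv ℝ L) z₀ v v - H * r * ‖WithLp.toLp 2 v‖ ^ 2 ≤ Q v v := by
    intro v
    have := hup (-v) v (-(fderiv ℝ (fderiv ℝ L) z₀ v v - H * r * ‖WithLp.toLp 2 v‖ ^ 2))
      fun t ht => by
        rw [map_neg, neg_apply]
        linarith [neg_le_of_abs_le (hdiff v t ht)]
    rw [map_neg, neg_apply] at this
    linarith
  rw [inner_toLp, norm_toLp_sq]
  refine inner_le_of_dominance hρ hη hα Q hsymm hx hy (fun a => ?_) (fun b => ?_) fun v w => ?_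
  · obtain ⟨b, hb1, hb2⟩ := hdx a
    have h1 := hQlow (a, b)
    rw [norm_toLp_sq] at h1
    have h2 := mul_le_mul_of_nonneg_left (sq_add_sq_le_of_mul_le (norm_nonneg b) hηρ hb1) hHr
    exact ⟨b, by linarith⟩
  · obtain ⟨a, ha1, ha2⟩ := hdy b
    have h1 := hQup (a, b)
    rw [norm_toLp_sq] at h1
    have h2 := mul_le_mul_of_nonneg_left (sq_add_sq_le_of_mul_le (norm_nonneg a) hηρ ha1) hHr
    exact ⟨a, by linarith⟩
  · rw [← hQ, sub_apply, ha.fderiv_eq hL, hb.fderiv_eq hL]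
    simp only [Prod.fst_sub, Prod.snd_sub, inner_sub_left]
    ring

theorem exists_dominance_witness_x (hL : ContDiff ℝ 2 L) (hweak : WeaklyConvexConcave ρ L)
    (hη : ρ < η) {δ α₀ : ℝ} {z₀ : Eu n × Eu m} (hδ : ‖Hxy L z₀‖ ≤ δ) {a : Eu n}
    (hdom : α₀ * ‖a‖ ^ 2 ≤
      ⟪(Hxx L z₀) a + (Hxy L z₀)
        ((Ring.inverse (η • (1 : Eu m →L[ℝ] Eu m) - Hyy L z₀)) ((Hyx L z₀) a)), a⟫) :
    ∃ b : Eu m, (η - ρ) * ‖b‖ ≤ δ * ‖a‖ ∧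
      α₀ * ‖a‖ ^ 2 ≤ fderiv ℝ (fderiv ℝ L) z₀ (a, b) (a, b) - η * ‖b‖ ^ 2 := by
  obtain ⟨b, hb1, hb2⟩ := exists_schur_partner (sub_pos.2 hη) ((norm_nonneg _).trans hδ)
    (fun b => by
      have := (hweak z₀).2 b
      simp only [sub_apply, smul_apply, one_apply_eq_self, inner_sub_left, inner_smul_left,
        real_inner_self_eq_norm_sq, conj_trivial]
      linarith)
    (fun w v => by rw [inner_Hxy hL, inner_Hyx hL, fderiv_fderiv_symm hL])
    (fun w v => (real_inner_le_norm _ _).trans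
      (mul_le_mul_of_nonneg_right ((Hxy L z₀).le_of_opNorm_le hδ w) (norm_nonneg v))) hdom
  refine ⟨b, hb1, hb2.trans_eq ?_⟩
  rw [← hessForm_eq hL, hessForm]
  have : ⟪Hyx L z₀ a, b⟫ = ⟪Hxy L z₀ b, a⟫ := by
    rw [inner_Hxy hL, inner_Hyx hL, fderiv_fderiv_symm hL]
  simp only [sub_apply, smul_apply, one_apply_eq_self, inner_sub_left, inner_smul_left,
    real_inner_self_eq_norm_sq, conj_trivial, this]
  ring

theorem exists_dominance_witness_y (hL : ContDiff ℝ 2 L) (hweak : WeaklyConvexConcave ρ L)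
    (hη : ρ < η) {δ α₀ : ℝ} {z₀ : Eu n × Eu m} (hδ : ‖Hxy L z₀‖ ≤ δ) {b : Eu m}
    (hdom : α₀ * ‖b‖ ^ 2 ≤
      ⟪-((Hyy L z₀) b) + (Hyx L z₀)
        ((Ring.inverse (η • (1 : Eu n →L[ℝ] Eu n) + Hxx L z₀)) ((Hxy L z₀) b)), b⟫) :
    ∃ a : Eu n, (η - ρ) * ‖a‖ ≤ δ * ‖b‖ ∧
      α₀ * ‖b‖ ^ 2 ≤ -fderiv ℝ (fderiv ℝ L) z₀ (a, b) (a, b) - η * ‖a‖ ^ 2 := by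
  have hsymm : ∀ v w, ⟪Hyx L z₀ v, w⟫ = ⟪Hxy L z₀ w, v⟫ := fun v w => by
    rw [inner_Hxy hL, inner_Hyx hL, fderiv_fderiv_symm hL]
  obtain ⟨a, ha1, ha2⟩ := exists_schur_partner (sub_pos.2 hη) ((norm_nonneg _).trans hδ)
    (fun a => by
      have := (hweak z₀).1 a
      simp only [add_apply, smul_apply, one_apply_eq_self, inner_add_left, inner_smul_left,
        real_inner_self_eq_norm_sq, conj_trivial]
      linarith)
    hsymm
    (fun v w => by
      rw [hsymm]
      refine (real_inner_le_norm _ _).trans ((mul_le_mul_of_nonneg_right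
        ((Hxy L z₀).le_of_opNorm_le hδ w) (norm_nonneg v)).trans_eq ?_)
      ring) hdom
  refine ⟨-a, by rwa [norm_neg], ha2.trans_eq ?_⟩
  rw [← hessForm_eq hL, hessForm]
  simp only [add_apply, smul_apply, one_apply_eq_self, inner_add_left, inner_smul_left,
    real_inner_self_eq_norm_sq, conj_trivial, hsymm, map_neg, inner_neg_left, inner_neg_right,
    norm_neg]
  ring

theorem prox_eq_self_of_gradient_eq_zero (hL : ContDiff ℝ 2 L) (hweak : WeaklyConvexConcave ρ L)
    (hη : ρ < η) {z w : Eu n × Eu m} (h : IsProxPoint η L z w)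
    (hg : Real.sqrt (‖gradx L z‖ ^ 2 + ‖grady L z‖ ^ 2) = 0) : w = z := by
  have h1 := (norm_prox_sub_le hL hweak h).1
  rw [hg] at h1
  have h2 : ‖WithLp.toLp 2 (w - z)‖ ≤ 0 := by
    by_contra! h
    nlinarith [mul_pos (sub_pos.2 hη) h]
  rw [norm_le_zero_iff, WithLp.toLp_eq_zero] at h2
  exact sub_eq_zero.1 h2

theorem norm_prox_sub_center_le (hL : ContDiff ℝ 2 L) (hweak : WeaklyConvexConcave ρ L)
    (hη0 : 0 < η) (hη : ρ < η) {a z pa pz : Eu n × Eu m} (ha : IsProxPoint η L a pa)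
    (hz : IsProxPoint η L z pz) {R : ℝ} (haR : ‖WithLp.toLp 2 (a - z)‖ ≤ R) :
    ‖WithLp.toLp 2 (pa - z)‖ ≤
      (η * R + Real.sqrt (‖gradx L z‖ ^ 2 + ‖grady L z‖ ^ 2)) / (η - ρ) := by
  have hd0 : 0 < η - ρ := sub_pos.2 hη
  have h1 := prox_cocoercive hL hweak ha hz
  have h2 : (η - ρ) * ‖WithLp.toLp 2 (pa - pz)‖ ≤ η * ‖WithLp.toLp 2 (a - z)‖ := by
    rcases (norm_nonneg (WithLp.toLp 2 (pa - pz))).eq_or_lt with h0 | h0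
    · rw [← h0, mul_zero]; positivity
    · refine le_of_mul_le_mul_right ?_ h0
      nlinarith [real_inner_le_norm (WithLp.toLp 2 (pa - pz)) (WithLp.toLp 2 (a - z))]
  have h3 := (norm_prox_sub_le hL hweak hz).1
  have h4 : ‖WithLp.toLp 2 (pa - z)‖ ≤
      ‖WithLp.toLp 2 (pa - pz)‖ + ‖WithLp.toLp 2 (pz - z)‖ := by
    rw [← sub_add_sub_cancel pa pz z, WithLp.toLp_add]
    exact norm_add_le _ _
  rw [le_div_iff₀ hd0]
  nlinarith

end Prox

theorem dominance_margin {ρ η β H δ α₀ g : ℝ} (hη : ρ < η) (hη0 : 0 < η) (hα₀ : 0 < α₀)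
    (hβ : 0 ≤ β) (hδ : 0 ≤ δ) (hg : 0 < g)
    (hgrad : g ≤ α₀ * (η - ρ) /
        (2 * (1 + 4 * Real.sqrt 2 * (η + α₀ / 2) / α₀ +
            4 * Real.sqrt 2 * β * (η + α₀ / 2) / (α₀ * (η - ρ))) *
          H * (1 + 2 * δ / (η - ρ) + δ ^ 2 / (η - ρ) ^ 2))) :
    0 < H ∧ H * ((η * (2 * (g * (1 + β / (η - ρ)) / η) / (1 / (2 * η / α₀ + 1))) + g) / (η - ρ)) *
      (1 + (δ / (η - ρ)) ^ 2) < α₀ / 2 := by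
  obtain ⟨d, hd⟩ : ∃ d, d = η - ρ := ⟨_, rfl⟩
  have hd0 : 0 < d := by rw [hd]; linarith
  rw [← hd] at hgrad ⊢
  set X := (η + α₀ / 2) / α₀ * (1 + β / d) with hX
  have hX0 : 0 < X := by positivity
  have hs : 1 < Real.sqrt 2 := by
    rw [Real.lt_sqrt (by norm_num)]; norm_num
  have hC : 1 + 4 * Real.sqrt 2 * (η + α₀ / 2) / α₀ +
      4 * Real.sqrt 2 * β * (η + α₀ / 2) / (α₀ * d) = 1 + 4 * Real.sqrt 2 * X := by
    rw [hX]; field_simp; ring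
  have hK : 1 + 2 * δ / d + δ ^ 2 / d ^ 2 = (1 + δ / d) ^ 2 := by
    field_simp; ring
  rw [hC, hK] at hgrad
  have hκ : 0 ≤ δ / d := by positivity
  have hden : 0 < 2 * (1 + 4 * Real.sqrt 2 * X) * H * (1 + δ / d) ^ 2 := by
    by_contra! h
    have := div_nonpos_of_nonneg_of_nonpos (by positivity : 0 ≤ α₀ * d) h
    linarith
  have hH : 0 < H := by
    by_contra! h
    have : 2 * (1 + 4 * Real.sqrt 2 * X) * H * (1 + δ / d) ^ 2 ≤ 0 :=
      mul_nonpos_of_nonpos_of_nonneg (mul_nonpos_of_nonneg_of_nonpos (by positivity) h)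
        (by positivity)
    linarith
  refine ⟨hH, ?_⟩
  rw [le_div_iff₀ hden] at hgrad
  have e : η * (2 * (g * (1 + β / d) / η) / (1 / (2 * η / α₀ + 1))) + g = g * (1 + 4 * X) := by
    rw [hX]; field_simp; ring
  rw [e]
  have h1 : H * (g * (1 + 4 * X)) * (1 + (δ / d) ^ 2) <
      H * (g * (1 + 4 * Real.sqrt 2 * X)) * (1 + δ / d) ^ 2 := by
    have h2 : 1 + (δ / d) ^ 2 ≤ (1 + δ / d) ^ 2 := by nlinarith
    have h3 : 1 + 4 * X < 1 + 4 * Real.sqrt 2 * X := by nlinarith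
    have h4 : 0 < 1 + (δ / d) ^ 2 := by positivity
    calc H * (g * (1 + 4 * X)) * (1 + (δ / d) ^ 2)
        < H * (g * (1 + 4 * Real.sqrt 2 * X)) * (1 + (δ / d) ^ 2) := by gcongr
      _ ≤ _ := by gcongr
  have e2 : H * (g * (1 + 4 * X) / d) * (1 + (δ / d) ^ 2) =
      H * (g * (1 + 4 * X)) * (1 + (δ / d) ^ 2) / d := by ring
  rw [e2, div_lt_iff₀ hd0]
  nlinarith

/-- local linear convergence of the damped proximal point method
in the interaction weak regime, from a well-initialized point. -/
theorem statement10 {n m : ℕ}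
    (L : Eu n × Eu m → ℝ) (ρ η β H δ α₀ lam : ℝ)
    (hL : ContDiff ℝ 2 L)
    (hρ : 0 < ρ)
    (hweak : WeaklyConvexConcave ρ L)
    (hη : ρ < η)
    (hβ : ∀ z v w : Eu n × Eu m, |hessForm L z v w| ≤
      β * Real.sqrt (‖v.1‖ ^ 2 + ‖v.2‖ ^ 2) * Real.sqrt (‖w.1‖ ^ 2 + ‖w.2‖ ^ 2))
    (hH : ∀ z zb v w : Eu n × Eu m, |hessForm L z v w - hessForm L zb v w| ≤
      H * Real.sqrt (‖z.1 - zb.1‖ ^ 2 + ‖z.2 - zb.2‖ ^ 2) *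
        Real.sqrt (‖v.1‖ ^ 2 + ‖v.2‖ ^ 2) * Real.sqrt (‖w.1‖ ^ 2 + ‖w.2‖ ^ 2))
    (hδ : ∀ z : Eu n × Eu m, ‖Hxy L z‖ ≤ δ)
    (z₀ : Eu n × Eu m)
    (hα₀ : 0 < α₀)
    (hdomx0 : ∀ v : Eu n, α₀ * ‖v‖ ^ 2 ≤
      ⟪(Hxx L z₀) v + (Hxy L z₀)
        ((Ring.inverse (η • (1 : Eu m →L[ℝ] Eu m) - Hyy L z₀)) ((Hyx L z₀) v)), v⟫)
    (hdomy0 : ∀ w : Eu m, α₀ * ‖w‖ ^ 2 ≤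
      ⟪-((Hyy L z₀) w) + (Hyx L z₀)
        ((Ring.inverse (η • (1 : Eu n →L[ℝ] Eu n) + Hxx L z₀)) ((Hxy L z₀) w)), w⟫)
    (hgrad : Real.sqrt (‖gradx L z₀‖ ^ 2 + ‖grady L z₀‖ ^ 2) ≤
      α₀ * (η - ρ) /
        (2 * (1 + 4 * Real.sqrt 2 * (η + α₀ / 2) / α₀ +
            4 * Real.sqrt 2 * β * (η + α₀ / 2) / (α₀ * (η - ρ))) *
          H * (1 + 2 * δ / (η - ρ) + δ ^ 2 / (η - ρ) ^ 2)))
    (hlam0 : 0 < lam) (hlam1 : lam ≤ 1)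
    (hlam : lam ≤ 2 * min 1 ((η / ρ - 1) ^ 2) / (2 * η / α₀ + 1))
    (prox : Eu n × Eu m → Eu n × Eu m)
    (hprox : ∀ z, IsProxPoint η L z (prox z))
    (hprox_uniq : ∀ z w, IsProxPoint η L z w → w = prox z)
    (z : ℕ → Eu n × Eu m) (hz0 : z 0 = z₀)
    (hz : ∀ k, z (k + 1) = (1 - lam) • z k + lam • prox (z k)) :
    ∃ zs : Eu n × Eu m,
      (gradx L zs = 0 ∧ grady L zs = 0) ∧
      (∀ k, ‖(z k).1 - zs.1‖ ^ 2 + ‖(z k).2 - zs.2‖ ^ 2 ≤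
        (1 - 2 * lam / (2 * η / α₀ + 1) + lam ^ 2 / min 1 ((η / ρ - 1) ^ 2)) ^ k *
          (‖z₀.1 - zs.1‖ ^ 2 + ‖z₀.2 - zs.2‖ ^ 2)) ∧
      Tendsto z atTop (𝓝 zs) := by
  have hη0 : 0 < η := hρ.trans hη
  have hd0 : 0 < η - ρ := sub_pos.2 hη
  have hδ0 : 0 ≤ δ := (norm_nonneg _).trans (hδ z₀)
  obtain ⟨hstat1, hstat2⟩ := norm_prox_sub_le hL hweak (hprox z₀)
  have hstat2 := hstat2 β hβ
  set g := Real.sqrt (‖gradx L z₀‖ ^ 2 + ‖grady L z₀‖ ^ 2) with hg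
  have hg0 : 0 ≤ g := Real.sqrt_nonneg _
  rcases hg0.eq_or_lt with hg0 | hg0
  · have hgz : ‖gradx L z₀‖ ^ 2 + ‖grady L z₀‖ ^ 2 = 0 :=
      (Real.sqrt_eq_zero (by positivity)).1 hg0.symm
    have hgx : ‖gradx L z₀‖ ^ 2 = 0 := by
      nlinarith [sq_nonneg ‖gradx L z₀‖, sq_nonneg ‖grady L z₀‖]
    have hgy : ‖grady L z₀‖ ^ 2 = 0 := by linarith
    have hfix := prox_eq_self_of_gradient_eq_zero hL hweak hη (hprox z₀) hg0.symm
    have hconst : ∀ k, z k = z₀ := by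
      intro k
      induction k with
      | zero => exact hz0
      | succ k ih => rw [hz, ih, hfix]; module
    refine ⟨z₀, ⟨by simpa using hgx, by simpa using hgy⟩, fun k => by simp [hconst k], ?_⟩
    exact tendsto_const_nhds.congr fun k => (hconst k).symm
  have hβ0 : 0 ≤ β := by
    have h1 := (abs_nonneg _).trans (hβ z₀ (gradx L z₀, grady L z₀) (gradx L z₀, grady L z₀))
    by_contra! h
    have h2 : 0 < g * g := by positivity
    rw [← hg] at h1
    nlinarith
  obtain ⟨hH0, hmargin⟩ := dominance_margin hη hη0 hα₀ hβ0 hδ0 hg0 hgrad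
  set θ := 1 / (2 * η / α₀ + 1) with hθ
  have hθ0 : 0 < θ := by positivity
  set R := 2 * (g * (1 + β / (η - ρ)) / η) / θ with hR
  have hR0 : 0 ≤ R := by positivity
  set r := (η * R + g) / (η - ρ) with hr
  set α := α₀ - H * r * (1 + (δ / (η - ρ)) ^ 2) with hα
  have hα' : α₀ / 2 < α := by linarith
  have hαpos : 0 < α := by linarith
  set θ' := α / (η + α) with hθ'
  have hθθ' : θ < θ' := by
    have : θ = (α₀ / 2) / (η + α₀ / 2) := by rw [hθ]; field_simp
    rw [this, hθ', div_lt_div_iff₀ (by positivity) (by positivity)]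
    nlinarith
  have hθ'1 : θ' < 1 := by
    rw [hθ', div_lt_one (by positivity)]; linarith
  have hloc' : ∀ a b : Eu n × Eu m, ‖WithLp.toLp 2 (a - z₀)‖ ≤ R → ‖WithLp.toLp 2 (b - z₀)‖ ≤ R →
      ⟪WithLp.toLp 2 (prox a - prox b), WithLp.toLp 2 (a - b)⟫ ≤
        (1 - θ') * ‖WithLp.toLp 2 (a - b)‖ ^ 2 := by
    intro a b ha hb
    have h1 : 1 - θ' = η / (η + α) := by rw [hθ']; field_simp; ring
    rw [h1]
    exact prox_inner_le hL hweak hρ hη hH0.le hH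
      (fun a => exists_dominance_witness_x hL hweak hη (hδ z₀) (hdomx0 a))
      (fun b => exists_dominance_witness_y hL hweak hη (hδ z₀) (hdomy0 b)) hαpos
      (hprox a) (hprox b) (norm_prox_sub_center_le hL hweak hη0 hη (hprox a) (hprox z₀) ha)
      (norm_prox_sub_center_le hL hweak hη0 hη (hprox b) (hprox z₀) hb)
  clear_value r α θ' R θ g
  let P : WithLp 2 (Eu n × Eu m) → WithLp 2 (Eu n × Eu m) :=
    fun x => WithLp.toLp 2 (prox (WithLp.ofLp x))
  have hmono : ∀ a b, (η - ρ) * ‖P a - P b‖ ^ 2 ≤ η * ⟪P a - P b, a - b⟫ := fun a b =>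
    prox_cocoercive hL hweak (hprox (WithLp.ofLp a)) (hprox (WithLp.ofLp b))
  have hloc : ∀ a b, ‖a - WithLp.toLp 2 z₀‖ ≤ R → ‖b - WithLp.toLp 2 z₀‖ ≤ R →
      ⟪P a - P b, a - b⟫ ≤ (1 - θ') * ‖a - b‖ ^ 2 := fun a b ha hb =>
    hloc' (WithLp.ofLp a) (WithLp.ofLp b) ha hb
  have hN : ‖WithLp.toLp 2 z₀ - P (WithLp.toLp 2 z₀)‖ ≤ θ' * R / 2 := by
    have h1 : ‖WithLp.toLp 2 (prox z₀ - z₀)‖ ≤ g * (1 + β / (η - ρ)) / η := by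
      have h2 : ‖WithLp.toLp 2 (prox z₀ - z₀)‖ ≤ g / (η - ρ) := by
        rw [le_div_iff₀ hd0]; linarith
      have h3 := mul_le_mul_of_nonneg_left h2 hβ0
      have h4 : g * (1 + β / (η - ρ)) = g + β * (g / (η - ρ)) := by ring
      rw [le_div_iff₀ hη0, h4]
      linarith
    have h5 : θ * R / 2 = g * (1 + β / (η - ρ)) / η := by rw [hR]; field_simp
    have h6 : θ * R ≤ θ' * R := mul_le_mul_of_nonneg_right hθθ'.le hR0
    rw [norm_sub_rev]
    change ‖WithLp.toLp 2 (prox z₀ - z₀)‖ ≤ _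
    linarith
  obtain ⟨zs, hfix, hzs⟩ := exists_fixedPoint_of_locally_strongly_monotone hρ hη
    (hθ0.trans hθθ') hθ'1 hR0 hmono hloc hN
  have hM0 : 0 < min 1 ((η / ρ - 1) ^ 2) := by
    have : 0 < η / ρ - 1 := by rw [sub_pos, lt_div_iff₀ hρ]; linarith
    positivity
  have hlamθ : 2 * lam * θ ≥ lam ^ 2 / min 1 ((η / ρ - 1) ^ 2) := by
    have h1 : lam ≤ 2 * θ * min 1 ((η / ρ - 1) ^ 2) := hlam.trans_eq (by rw [hθ]; ring)
    rw [ge_iff_le, div_le_iff₀ hM0]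
    nlinarith
  obtain ⟨hrate, htend⟩ := relaxed_iterates_contract hρ hη hθθ' (hθθ'.trans hθ'1).le hlam0 hlamθ
    hfix hzs hmono hloc (z := fun k => WithLp.toLp 2 (z k)) (by rw [hz0]) fun k => by
      rw [hz, WithLp.toLp_add, WithLp.toLp_smul, WithLp.toLp_smul]
  have hfix' : prox (WithLp.ofLp zs) = WithLp.ofLp zs := congrArg WithLp.ofLp hfix
  have hcrit : ∀ v v', fderiv ℝ L (WithLp.ofLp zs) (v, v') = 0 := fun v v' => by
    have h1 := hprox (WithLp.ofLp zs)
    rw [hfix'] at h1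
    simpa using h1.fderiv_eq hL v v'
  refine ⟨WithLp.ofLp zs, ⟨?_, ?_⟩, fun k => ?_, ?_⟩
  · exact ext_inner_right ℝ fun v => (inner_gradient_fst hL _ _ v).trans (by
      rw [inner_zero_left]; exact hcrit v 0)
  · exact ext_inner_right ℝ fun v => (inner_gradient_snd hL _ _ v).trans (by
      rw [inner_zero_left]; exact hcrit 0 v)
  · have h1 := hrate k
    have h2 : ‖WithLp.toLp 2 (z k) - zs‖ ^ 2 = _ := norm_toLp_sq (z k - WithLp.ofLp zs)
    have h3 : ‖WithLp.toLp 2 z₀ - zs‖ ^ 2 = _ := norm_toLp_sq (z₀ - WithLp.ofLp zs)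
    rw [h2, h3, hθ, mul_one_div] at h1
    exact h1
  · exact ((WithLp.prod_continuous_ofLp 2 _ _).tendsto zs).comp htend

end
end

section
/- Let L : ℝⁿ × ℝᵐ → ℝ be twice continuously differentiable and ρ-weakly convex–weakly concave, and let η > max(ρ, 0). Define g(x,y) = e_η{L(·,y)}(x) = min_u [L(u,y) + (η/2)‖u−x‖²]. Then: (a) for every (x,y), g is twice differentiable in x with (−ηρ/(η−ρ)) I ⪯ ∇²_{xx} g(x,y) ⪯ ηI; and (b) if L is α-interaction dominant with respect to y for some α ∈ ℝ, then g is twice differentiable in y with ∇_y g(x,y) = ∇_y L(x₊, y) and ∇²_{yy} g(x,y) ⪯ −αI, where x₊ = argmin_u [L(u,y) + (η/2)‖u−x‖²]. Symmetrically, h(x,y) = e_η{−L(x,·)}(y) satisfies (−ηρ/(η−ρ)) I ⪯ ∇²_{yy} h(x,y) ⪯ ηI, and if L is α-interaction dominant with respect to x then ∇²_{xx} h(x,y) ⪯ −αI. -/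
open Filter Topology Metric
open scoped RealInnerProductSpace

noncomputable section

section StrongMonotonicity

variable {E : Type*} [NormedAddCommGroup E] [InnerProductSpace ℝ E]

/-- A vector field whose derivative is bounded below by `μ` is `μ`-strongly monotone. -/
lemma mul_sq_norm_sub_le_inner_sub {G : E → E} {G' : E → E →L[ℝ] E} {μ : ℝ}
    (hG : ∀ x, HasFDerivAt G (G' x) x) (hμ : ∀ x v, μ * ‖v‖ ^ 2 ≤ ⟪G' x v, v⟫) (a u : E) :
    μ * ‖u - a‖ ^ 2 ≤ ⟪G u - G a, u - a⟫ := by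
  set v := u - a with hv
  have hline (t : ℝ) : HasDerivAt (fun t : ℝ => a + t • v) v t := by
    simpa using ((hasDerivAt_id t).smul_const v).const_add a
  have hφ (t : ℝ) : HasDerivAt (fun t : ℝ => ⟪G (a + t • v), v⟫ - t * (μ * ‖v‖ ^ 2))
      (⟪G' (a + t • v) v, v⟫ - μ * ‖v‖ ^ 2) t := by
    have h1 := ((hG (a + t • v)).comp_hasDerivAt t (hline t)).inner ℝ (hasDerivAt_const t v)
    refine (h1.sub ((hasDerivAt_id t).mul_const (μ * ‖v‖ ^ 2))).congr_deriv ?_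
    simp
  have hmono := monotone_of_deriv_nonneg (fun t => (hφ t).differentiableAt) (fun t => by
    rw [(hφ t).deriv]
    linarith [hμ (a + t • v) v])
  have h01 := hmono (zero_le_one' ℝ)
  have hu : a + v = u := by rw [hv]; abel
  simp only [zero_smul, add_zero, one_smul, hu] at h01
  rw [inner_sub_left]
  linarith

variable [CompleteSpace E]

/-- A function whose Hessian is bounded below by `μ` lies above its tangent paraboloids. -/
lemma add_inner_add_sq_norm_le {f : E → ℝ} {G : E → E} {G' : E → E →L[ℝ] E} {μ : ℝ}
    (hf : ∀ x, HasGradientAt f (G x) x) (hG : ∀ x, HasFDerivAt G (G' x) x)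
    (hμ : ∀ x v, μ * ‖v‖ ^ 2 ≤ ⟪G' x v, v⟫) (a u : E) :
    f a + ⟪G a, u - a⟫ + μ / 2 * ‖u - a‖ ^ 2 ≤ f u := by
  set v := u - a with hv
  have hline (t : ℝ) : HasDerivAt (fun t : ℝ => a + t • v) v t := by
    simpa using ((hasDerivAt_id t).smul_const v).const_add a
  have hφ (t : ℝ) : HasDerivAt
      (fun t : ℝ => f (a + t • v) - t * ⟪G a, v⟫ - t ^ 2 * (μ / 2 * ‖v‖ ^ 2))
      (⟪G (a + t • v), v⟫ - ⟪G a, v⟫ - t * (μ * ‖v‖ ^ 2)) t := by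
    have h1 := (hf (a + t • v)).hasFDerivAt.comp_hasDerivAt t (hline t)
    have h2 := (h1.sub ((hasDerivAt_id t).mul_const ⟪G a, v⟫)).sub
      ((hasDerivAt_pow 2 t).mul_const (μ / 2 * ‖v‖ ^ 2))
    refine h2.congr_deriv ?_
    simp
    ring
  have hmono : MonotoneOn
      (fun t : ℝ => f (a + t • v) - t * ⟪G a, v⟫ - t ^ 2 * (μ / 2 * ‖v‖ ^ 2))
      (Set.Icc 0 1) := by
    refine monotoneOn_of_deriv_nonneg (convex_Icc 0 1)
      (fun t _ => (hφ t).continuousAt.continuousWithinAt)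
      (fun t _ => (hφ t).differentiableAt.differentiableWithinAt) (fun t ht => ?_)
    rw [interior_Icc] at ht
    rw [(hφ t).deriv]
    have h1 := mul_sq_norm_sub_le_inner_sub hG hμ a (a + t • v)
    rw [add_sub_cancel_left, norm_smul, inner_smul_right, inner_sub_left, mul_pow,
      Real.norm_eq_abs, sq_abs] at h1
    refine nonneg_of_mul_nonneg_right (a := t) ?_ ht.1
    linarith
  have h01 := hmono (Set.left_mem_Icc.2 zero_le_one) (Set.right_mem_Icc.2 zero_le_one)
    (zero_le_one' ℝ)
  have hu : a + v = u := by rw [hv]; abel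
  simp only [zero_smul, add_zero, one_smul, hu] at h01
  linarith

/-- A strongly convex function on a finite-dimensional space attains its minimum. -/
lemma exists_forall_le_of_hessian_ge [FiniteDimensional ℝ E] {f : E → ℝ} {G : E → E}
    {G' : E → E →L[ℝ] E} {μ : ℝ} (hμ0 : 0 < μ)
    (hf : ∀ x, HasGradientAt f (G x) x) (hG : ∀ x, HasFDerivAt G (G' x) x)
    (hμ : ∀ x v, μ * ‖v‖ ^ 2 ≤ ⟪G' x v, v⟫) : ∃ p, ∀ u, f p ≤ f u := by
  have hcont : Continuous f :=
    continuous_iff_continuousAt.2 fun x => (hf x).continuousAt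
  refine hcont.exists_forall_le ?_
  have hnorm : Tendsto (fun u : E => ‖u‖) (cocompact E) atTop := tendsto_norm_cocompact_atTop
  have hlin : Tendsto (fun u : E => μ / 2 * ‖u‖ + -‖G 0‖) (cocompact E) atTop :=
    tendsto_atTop_add_const_right _ _ (hnorm.const_mul_atTop (half_pos hμ0))
  refine tendsto_atTop_mono (fun u => ?_)
    (tendsto_atTop_add_const_left _ (f 0) (hnorm.atTop_mul_atTop₀ hlin))
  have h1 := add_inner_add_sq_norm_le hf hG hμ 0 u
  have h2 := (abs_le.1 (abs_real_inner_le_norm (G 0) u)).1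
  rw [sub_zero] at h1
  nlinarith

end StrongMonotonicity

/-- A linear endomorphism with positive definite quadratic form is invertible. -/
lemma isUnit_of_coercive_s14 {n : ℕ} {T : Eu n →L[ℝ] Eu n} {μ : ℝ} (hμ0 : 0 < μ)
    (hT : ∀ v, μ * ‖v‖ ^ 2 ≤ ⟪T v, v⟫) : IsUnit T := by
  have hinj : Function.Injective T.toLinearMap := by
    rw [← LinearMap.ker_eq_bot, LinearMap.ker_eq_bot']
    intro v hv
    have h := hT v
    rw [show T v = 0 from hv, inner_zero_left] at h
    have : ‖v‖ ^ 2 = 0 := le_antisymm (by nlinarith) (sq_nonneg _)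
    simpa using this
  exact ⟨ContinuousLinearEquiv.toUnit
    (LinearEquiv.ofInjectiveEndo T.toLinearMap hinj).toContinuousLinearEquiv, by ext; rfl⟩

section PartialDerivatives

variable {n m : ℕ} {L : Eu n × Eu m → ℝ}

lemma hasGradientAt_gradx (hL : Differentiable ℝ L) (z : Eu n × Eu m) :
    HasGradientAt (fun u => L (u, z.2)) (gradx L z) z.1 :=
  ((hL z).comp z.1 (hasFDerivAt_prodMk_left z.1 z.2).differentiableAt).hasGradientAt

lemma hasGradientAt_grady (hL : Differentiable ℝ L) (z : Eu n × Eu m) :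
    HasGradientAt (fun v => L (z.1, v)) (grady L z) z.2 :=
  ((hL z).comp z.2 (hasFDerivAt_prodMk_right z.1 z.2).differentiableAt).hasGradientAt

lemma toDual_gradx (hL : Differentiable ℝ L) (z : Eu n × Eu m) :
    InnerProductSpace.toDual ℝ (Eu n) (gradx L z)
      = (fderiv ℝ L z).comp (ContinuousLinearMap.inl ℝ (Eu n) (Eu m)) :=
  (hasGradientAt_gradx hL z).hasFDerivAt.unique
    ((hL z).hasFDerivAt.comp z.1 (hasFDerivAt_prodMk_left z.1 z.2))

lemma toDual_grady (hL : Differentiable ℝ L) (z : Eu n × Eu m) :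
    InnerProductSpace.toDual ℝ (Eu m) (grady L z)
      = (fderiv ℝ L z).comp (ContinuousLinearMap.inr ℝ (Eu n) (Eu m)) :=
  (hasGradientAt_grady hL z).hasFDerivAt.unique
    ((hL z).hasFDerivAt.comp z.2 (hasFDerivAt_prodMk_right z.1 z.2))

lemma contDiff_gradx (hL : ContDiff ℝ 2 L) : ContDiff ℝ 1 (gradx L) := by
  have h : gradx L = fun z => (InnerProductSpace.toDual ℝ (Eu n)).symm
      ((fderiv ℝ L z).comp (ContinuousLinearMap.inl ℝ (Eu n) (Eu m))) := by
    funext z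
    rw [← toDual_gradx (hL.differentiable (by norm_num)), LinearIsometryEquiv.symm_apply_apply]
  rw [h]
  exact (InnerProductSpace.toDual ℝ (Eu n)).symm.contDiff.comp
    ((hL.fderiv_right (by norm_num)).clm_comp contDiff_const)

lemma contDiff_grady (hL : ContDiff ℝ 2 L) : ContDiff ℝ 1 (grady L) := by
  have h : grady L = fun z => (InnerProductSpace.toDual ℝ (Eu m)).symm
      ((fderiv ℝ L z).comp (ContinuousLinearMap.inr ℝ (Eu n) (Eu m))) := by
    funext z
    rw [← toDual_grady (hL.differentiable (by norm_num)), LinearIsometryEquiv.symm_apply_apply]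
  rw [h]
  exact (InnerProductSpace.toDual ℝ (Eu m)).symm.contDiff.comp
    ((hL.fderiv_right (by norm_num)).clm_comp contDiff_const)

lemma hasFDerivAt_gradx_left (hL : ContDiff ℝ 2 L) (z : Eu n × Eu m) :
    HasFDerivAt (fun u => gradx L (u, z.2)) (Hxx L z) z.1 :=
  (DifferentiableAt.comp (g := gradx L) z.1 ((contDiff_gradx hL).differentiable (by norm_num) z)
    (hasFDerivAt_prodMk_left z.1 z.2).differentiableAt).hasFDerivAt

lemma fderiv_apply_eq_add {F : Type*} [NormedAddCommGroup F] [NormedSpace ℝ F]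
    {f : Eu n × Eu m → F} {z : Eu n × Eu m} (hf : DifferentiableAt ℝ f z) (v : Eu n) (w : Eu m) :
    fderiv ℝ f z (v, w)
      = fderiv ℝ (fun x => f (x, z.2)) z.1 v + fderiv ℝ (fun y => f (z.1, y)) z.2 w := by
  have h1 : HasFDerivAt (fun x => f (x, z.2)) _ z.1 :=
    hf.hasFDerivAt.comp z.1 (hasFDerivAt_prodMk_left z.1 z.2)
  have h2 : HasFDerivAt (fun y => f (z.1, y)) _ z.2 :=
    hf.hasFDerivAt.comp z.2 (hasFDerivAt_prodMk_right z.1 z.2)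
  rw [h1.fderiv, h2.fderiv]
  simp [← map_add]

lemma fderiv_gradx_apply (hL : ContDiff ℝ 2 L) (z : Eu n × Eu m) (v : Eu n) (w : Eu m) :
    fderiv ℝ (gradx L) z (v, w) = Hxx L z v + Hxy L z w :=
  fderiv_apply_eq_add ((contDiff_gradx hL).differentiable (by norm_num) z) v w

lemma fderiv_grady_apply (hL : ContDiff ℝ 2 L) (z : Eu n × Eu m) (v : Eu n) (w : Eu m) :
    fderiv ℝ (grady L) z (v, w) = Hyx L z v + Hyy L z w :=
  fderiv_apply_eq_add ((contDiff_grady hL).differentiable (by norm_num) z) v w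

lemma fderiv_apply_eq_inner_add (hL : Differentiable ℝ L) (z : Eu n × Eu m)
    (v : Eu n) (w : Eu m) :
    fderiv ℝ L z (v, w) = ⟪gradx L z, v⟫ + ⟪grady L z, w⟫ := by
  rw [fderiv_apply_eq_add (hL z), (hasGradientAt_gradx hL z).hasFDerivAt.fderiv,
    (hasGradientAt_grady hL z).hasFDerivAt.fderiv]
  simp

end PartialDerivatives

section ProximalMap

variable {n m : ℕ} {L : Eu n × Eu m → ℝ} {ρ η : ℝ}

lemma hasGradientAt_proximal_objective (hL : Differentiable ℝ L) (η : ℝ) (x u : Eu n) (y : Eu m) :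
    HasGradientAt (fun u => L (u, y) + η / 2 * ‖u - x‖ ^ 2)
      (gradx L (u, y) + η • (u - x)) u := by
  have h1 := (hasGradientAt_gradx hL (u, y)).hasFDerivAt
  have h2 := (((hasFDerivAt_id u).sub_const x).norm_sq).const_mul (η / 2)
  refine (h1.add h2).congr_fderiv ?_
  ext v
  simp
  ring

lemma coercive_smul_one_add_Hxx
    (hxx : ∀ z v, -ρ * ‖v‖ ^ 2 ≤ ⟪(Hxx L z) v, v⟫) (z : Eu n × Eu m) (v : Eu n) :
    (η - ρ) * ‖v‖ ^ 2 ≤ ⟪(η • (1 : Eu n →L[ℝ] Eu n) + Hxx L z) v, v⟫ := by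
  have h := hxx z v
  simp only [add_apply, smul_apply, one_apply_eq_self, inner_add_left, real_inner_smul_left,
    real_inner_self_eq_norm_sq]
  linarith

/-- The proximal map of `L (·, y)`, with its first-order optimality condition and its
differentiability in both variables. -/
lemma exists_differentiable_prox (hL : ContDiff ℝ 2 L) (hη : 0 < η) (hρ : ρ < η)
    (hxx : ∀ z v, -ρ * ‖v‖ ^ 2 ≤ ⟪(Hxx L z) v, v⟫) :
    ∃ p : Eu n × Eu m → Eu n,
      (∀ z u, L (p z, z.2) + η / 2 * ‖p z - z.1‖ ^ 2 ≤ L (u, z.2) + η / 2 * ‖u - z.1‖ ^ 2) ∧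
      (∀ z, gradx L (p z, z.2) + η • (p z - z.1) = 0) ∧
      Differentiable ℝ p := by
  have hL1 : Differentiable ℝ L := hL.differentiable (by norm_num)
  have hgrad (z : Eu n × Eu m) (u : Eu n) := hasGradientAt_proximal_objective hL1 η z.1 u z.2
  have hder (z : Eu n × Eu m) (u : Eu n) :
      HasFDerivAt (fun u => gradx L (u, z.2) + η • (u - z.1))
        (η • (1 : Eu n →L[ℝ] Eu n) + Hxx L (u, z.2)) u := by
    rw [add_comm]
    exact (hasFDerivAt_gradx_left hL (u, z.2)).add
      (((hasFDerivAt_id u).sub_const z.1).const_smul η)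
  have hcoer (z : Eu n × Eu m) (u v : Eu n) :=
    coercive_smul_one_add_Hxx (η := η) hxx (u, z.2) v
  have hμ0 : 0 < η - ρ := sub_pos.2 hρ
  choose p hp using fun z =>
    exists_forall_le_of_hessian_ge hμ0 (hgrad z) (hder z) (hcoer z)
  have hcrit (z : Eu n × Eu m) : gradx L (p z, z.2) + η • (p z - z.1) = 0 := by
    have h := IsLocalMin.hasFDerivAt_eq_zero (Eventually.of_forall (hp z))
      (hgrad z (p z)).hasFDerivAt
    rwa [map_eq_zero_iff _ (InnerProductSpace.toDual ℝ (Eu n)).injective] at h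
  refine ⟨p, hp, hcrit, fun z => ?_⟩
  -- `p` is the first component of the global inverse of `Ψ`
  set Ψ : Eu n × Eu m → Eu n × Eu m := fun q => (q.1 + η⁻¹ • gradx L q, q.2) with hΨ
  have hleft (q : Eu n × Eu m) : (p (Ψ q), (Ψ q).2) = q := by
    refine Prod.ext ?_ rfl
    have h1 := mul_sq_norm_sub_le_inner_sub (hder (Ψ q)) (hcoer (Ψ q)) q.1 (p (Ψ q))
    have h2 : gradx L (q.1, (Ψ q).2) + η • (q.1 - (Ψ q).1) = 0 := by
      simp [hΨ, smul_smul, hη.ne']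
    rw [hcrit, h2, sub_zero, inner_zero_left] at h1
    have h3 : ‖p (Ψ q) - q.1‖ ^ 2 = 0 := le_antisymm (by nlinarith) (sq_nonneg _)
    simpa [sub_eq_zero] using h3
  have hright : Ψ (p z, z.2) = z := by
    refine Prod.ext ?_ rfl
    have h : gradx L (p z, z.2) = η • (z.1 - p z) := by
      rw [eq_neg_of_add_eq_zero_left (hcrit z), ← smul_neg, neg_sub]
    simp [hΨ, h, smul_smul, hη.ne']
  set q : Eu n × Eu m := (p z, z.2) with hq
  set A : Eu n × Eu m →L[ℝ] Eu n × Eu m :=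
    (ContinuousLinearMap.fst ℝ (Eu n) (Eu m) + η⁻¹ • fderiv ℝ (gradx L) q).prod
      (ContinuousLinearMap.snd ℝ (Eu n) (Eu m)) with hA
  have hΨA : HasStrictFDerivAt Ψ A q := by
    have h1 := ((contDiff_gradx hL).contDiffAt (x := q)).hasStrictFDerivAt (by norm_num)
    exact (hasStrictFDerivAt_fst.add (h1.const_smul η⁻¹)).prodMk hasStrictFDerivAt_snd
  have hAinj : Function.Injective A.toLinearMap := by
    rw [← LinearMap.ker_eq_bot, LinearMap.ker_eq_bot']
    rintro ⟨v, w⟩ hvw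
    have hw : w = 0 := congrArg Prod.snd hvw
    subst hw
    have hv : v + η⁻¹ • fderiv ℝ (gradx L) q (v, 0) = 0 := congrArg Prod.fst hvw
    rw [fderiv_gradx_apply hL, map_zero, add_zero] at hv
    have hT : (η • (1 : Eu n →L[ℝ] Eu n) + Hxx L q) v = 0 := by
      have := congrArg (fun a => η • a) hv
      simpa [smul_smul, hη.ne'] using this
    have h := coercive_smul_one_add_Hxx (η := η) hxx q v
    rw [hT, inner_zero_left] at h
    have h3 : ‖v‖ ^ 2 = 0 := le_antisymm (by nlinarith) (sq_nonneg _)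
    simpa using h3
  set A' : (Eu n × Eu m) ≃L[ℝ] (Eu n × Eu m) :=
    (LinearEquiv.ofInjectiveEndo A.toLinearMap hAinj).toContinuousLinearEquiv
  have hΨA' : HasStrictFDerivAt Ψ (A' : Eu n × Eu m →L[ℝ] Eu n × Eu m) q := hΨA
  have hinv := hΨA'.to_local_left_inverse (g := fun z => (p z, z.2)) (Eventually.of_forall hleft)
  rw [hright] at hinv
  exact hinv.hasFDerivAt.differentiableAt.fst

lemma moreau_eq_of_forall_le {f : Eu n → ℝ} {x p : Eu n}
    (hp : ∀ u, f p + η / 2 * ‖p - x‖ ^ 2 ≤ f u + η / 2 * ‖u - x‖ ^ 2) :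
    moreau η f x = f p + η / 2 * ‖p - x‖ ^ 2 :=
  le_antisymm (ciInf_le ⟨_, Set.forall_mem_range.2 hp⟩ p) (le_ciInf hp)

/-- Envelope theorem for the partial Moreau envelope, in both variables jointly. -/
lemma hasFDerivAt_partial_moreau (hL : Differentiable ℝ L) {p : Eu n × Eu m → Eu n}
    (hmin : ∀ z u,
      L (p z, z.2) + η / 2 * ‖p z - z.1‖ ^ 2 ≤ L (u, z.2) + η / 2 * ‖u - z.1‖ ^ 2)
    (hcrit : ∀ z, gradx L (p z, z.2) + η • (p z - z.1) = 0) (hp : Differentiable ℝ p)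
    (z : Eu n × Eu m) :
    HasFDerivAt (fun z : Eu n × Eu m => moreau η (fun u => L (u, z.2)) z.1)
      ((InnerProductSpace.toDual ℝ (Eu n) (η • (z.1 - p z))).coprod
        (InnerProductSpace.toDual ℝ (Eu m) (grady L (p z, z.2)))) z := by
  have hval : (fun z : Eu n × Eu m => moreau η (fun u => L (u, z.2)) z.1)
      = fun z => L (p z, z.2) + η / 2 * ‖p z - z.1‖ ^ 2 :=
    funext fun z => moreau_eq_of_forall_le (f := fun u => L (u, z.2)) (hmin z)
  rw [hval]
  have hpz := (hp z).hasFDerivAt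
  have h1 := (hL (p z, z.2)).hasFDerivAt.comp z (hpz.prodMk hasFDerivAt_snd)
  have h2 := ((hpz.sub hasFDerivAt_fst).norm_sq).const_mul (η / 2)
  refine (h1.add h2).congr_fderiv (ContinuousLinearMap.ext fun ⟨v, w⟩ => ?_)
  have hg : gradx L (p z, z.2) = -(η • (p z - z.1)) := eq_neg_of_add_eq_zero_left (hcrit z)
  simp [fderiv_apply_eq_inner_add hL, hg, inner_sub_left, inner_smul_left]
  ring

lemma hasGradientAt_moreau_left (hL : Differentiable ℝ L) {p : Eu n × Eu m → Eu n}
    (hmin : ∀ z u,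
      L (p z, z.2) + η / 2 * ‖p z - z.1‖ ^ 2 ≤ L (u, z.2) + η / 2 * ‖u - z.1‖ ^ 2)
    (hcrit : ∀ z, gradx L (p z, z.2) + η • (p z - z.1) = 0) (hp : Differentiable ℝ p)
    (x : Eu n) (y : Eu m) :
    HasGradientAt (moreau η (fun u => L (u, y))) (η • (x - p (x, y))) x := by
  have h := HasFDerivAt.comp (f := fun x => (x, y)) x
    (hasFDerivAt_partial_moreau hL hmin hcrit hp (x, y)) (hasFDerivAt_prodMk_left x y)
  refine h.congr_fderiv ?_
  ext v
  simp

lemma hasGradientAt_moreau_right (hL : Differentiable ℝ L) {p : Eu n × Eu m → Eu n}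
    (hmin : ∀ z u,
      L (p z, z.2) + η / 2 * ‖p z - z.1‖ ^ 2 ≤ L (u, z.2) + η / 2 * ‖u - z.1‖ ^ 2)
    (hcrit : ∀ z, gradx L (p z, z.2) + η • (p z - z.1) = 0) (hp : Differentiable ℝ p)
    (x : Eu n) (y : Eu m) :
    HasGradientAt (fun y => moreau η (fun u => L (u, y)) x) (grady L (p (x, y), y)) y := by
  have h := HasFDerivAt.comp (f := fun y => (x, y)) y
    (hasFDerivAt_partial_moreau hL hmin hcrit hp (x, y)) (hasFDerivAt_prodMk_right x y)
  refine h.congr_fderiv ?_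
  ext v
  simp

/-- Implicit differentiation of the optimality condition of the proximal map. -/
lemma smul_one_add_Hxx_fderiv_prox (hL : ContDiff ℝ 2 L) {p : Eu n × Eu m → Eu n}
    (hcrit : ∀ z, gradx L (p z, z.2) + η • (p z - z.1) = 0) (hp : Differentiable ℝ p)
    (z : Eu n × Eu m) (v : Eu n) (w : Eu m) :
    (η • (1 : Eu n →L[ℝ] Eu n) + Hxx L (p z, z.2)) (fderiv ℝ p z (v, w))
      = η • v - Hxy L (p z, z.2) w := by
  have hpz := (hp z).hasFDerivAt
  have h1 := ((contDiff_gradx hL).differentiable (by norm_num) (p z, z.2)).hasFDerivAt.comp z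
    (hpz.prodMk hasFDerivAt_snd)
  have h2 := h1.add ((hpz.sub hasFDerivAt_fst).const_smul η)
  have h0 := h2.unique ((hasFDerivAt_const (0 : Eu n) z).congr_of_eventuallyEq
    (Eventually.of_forall hcrit))
  have h := congrArg (fun A => A (v, w)) h0
  simp [fderiv_gradx_apply hL, smul_sub] at h
  rw [← sub_eq_zero, ← h]
  simp
  abel

/-- Two-sided bounds on the Hessian of a partial Moreau envelope in the proximal variable. -/
lemma hessian_moreau_left_bounds (hL : ContDiff ℝ 2 L) (hη : 0 < η) (hρ : ρ < η)
    (hxx : ∀ z v, -ρ * ‖v‖ ^ 2 ≤ ⟪(Hxx L z) v, v⟫) (x : Eu n) (y : Eu m) :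
    ∃ Hg : Eu n →L[ℝ] Eu n,
      HasFDerivAt (fun x => gradient (moreau η (fun u => L (u, y))) x) Hg x ∧
      ∀ v : Eu n,
        -(η * ρ) / (η - ρ) * ‖v‖ ^ 2 ≤ ⟪Hg v, v⟫ ∧ ⟪Hg v, v⟫ ≤ η * ‖v‖ ^ 2 := by
  obtain ⟨p, hmin, hcrit, hp⟩ := exists_differentiable_prox hL hη hρ hxx
  have hgrad : (fun x => gradient (moreau η (fun u => L (u, y))) x)
      = fun x => η • (x - p (x, y)) :=
    funext fun x => (hasGradientAt_moreau_left (hL.differentiable (by norm_num))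
      hmin hcrit hp x y).gradient
  have hpx : HasFDerivAt (fun x => p (x, y)) _ x :=
    HasFDerivAt.comp (f := fun x => (x, y)) x (hp (x, y)).hasFDerivAt
      (hasFDerivAt_prodMk_left x y)
  have hder : HasFDerivAt (fun x => η • (x - p (x, y))) _ x :=
    ((hasFDerivAt_id x).sub hpx).const_smul η
  refine ⟨_, hgrad ▸ hder, fun v => ?_⟩
  have hs := smul_one_add_Hxx_fderiv_prox hL hcrit hp (x, y) v 0
  have hc := coercive_smul_one_add_Hxx (η := η) hxx (p (x, y), y) (fderiv ℝ p (x, y) (v, 0))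
  set s := fderiv ℝ p (x, y) (v, 0) with hsdef
  rw [map_zero, sub_zero] at hs
  rw [hs, real_inner_smul_left, real_inner_comm] at hc
  have hval : ⟪(η • (ContinuousLinearMap.id ℝ (Eu n)
      - (fderiv ℝ p (x, y)).comp (ContinuousLinearMap.inl ℝ (Eu n) (Eu m)))) v, v⟫
        = η * ‖v‖ ^ 2 - η * ⟪s, v⟫ := by
    simp [inner_sub_left, real_inner_smul_left, hsdef, mul_sub]
  have hμ0 : 0 < η - ρ := sub_pos.2 hρ
  have hsv := real_inner_le_norm s v
  have hnorm : (η - ρ) * ‖s‖ ≤ η * ‖v‖ := by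
    rcases (norm_nonneg s).eq_or_lt with h0 | h0
    · rw [← h0, mul_zero]
      positivity
    · refine le_of_mul_le_mul_right ?_ h0
      nlinarith
  refine ⟨?_, ?_⟩
  · refine le_of_le_of_eq ?_ hval.symm
    rw [div_mul_eq_mul_div, div_le_iff₀ hμ0]
    have h1 : (η - ρ) * ⟪s, v⟫ ≤ η * ‖v‖ ^ 2 := by
      nlinarith [norm_nonneg v]
    nlinarith
  · refine le_of_eq_of_le hval ?_
    nlinarith [mul_nonneg hμ0.le (sq_nonneg ‖s‖)]

/-- Under interaction dominance, gradient and Hessian of a partial Moreau envelope in the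
parameter variable. -/
lemma gradient_hessian_moreau_right (hL : ContDiff ℝ 2 L) (hη : 0 < η) (hρ : ρ < η)
    (hxx : ∀ z v, -ρ * ‖v‖ ^ 2 ≤ ⟪(Hxx L z) v, v⟫) {α : ℝ} (hdom : IntDomY η α L)
    (x : Eu n) (y : Eu m) :
    ∃ xp : Eu n,
      (∀ u : Eu n, L (xp, y) + η / 2 * ‖xp - x‖ ^ 2 ≤ L (u, y) + η / 2 * ‖u - x‖ ^ 2) ∧
      HasGradientAt (fun y => moreau η (fun u => L (u, y)) x) (grady L (xp, y)) y ∧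
      ∃ Hg : Eu m →L[ℝ] Eu m,
        HasFDerivAt (fun y => gradient (fun y' => moreau η (fun u => L (u, y')) x) y) Hg y ∧
        ∀ w : Eu m, ⟪Hg w, w⟫ ≤ -α * ‖w‖ ^ 2 := by
  obtain ⟨p, hmin, hcrit, hp⟩ := exists_differentiable_prox hL hη hρ hxx
  have hgr := hasGradientAt_moreau_right (hL.differentiable (by norm_num)) hmin hcrit hp x
  refine ⟨p (x, y), hmin (x, y), hgr y, ?_⟩
  have hgrad : (fun y => gradient (fun y' => moreau η (fun u => L (u, y')) x) y)
      = fun y => grady L (p (x, y), y) := funext fun y => (hgr y).gradient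
  have hpy : HasFDerivAt (fun y => p (x, y)) _ y :=
    HasFDerivAt.comp (f := fun y => (x, y)) y (hp (x, y)).hasFDerivAt
      (hasFDerivAt_prodMk_right x y)
  have hder : HasFDerivAt (fun y => grady L (p (x, y), y)) _ y :=
    HasFDerivAt.comp (g := grady L) (f := fun y => (p (x, y), y)) y
      ((contDiff_grady hL).differentiable (by norm_num) (p (x, y), y)).hasFDerivAt
      (hpy.prodMk (hasFDerivAt_id y))
  refine ⟨_, hgrad ▸ hder, fun w => ?_⟩
  set q : Eu n × Eu m := (p (x, y), y) with hq
  have hs := smul_one_add_Hxx_fderiv_prox hL hcrit hp (x, y) 0 w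
  have hunit : IsUnit (η • (1 : Eu n →L[ℝ] Eu n) + Hxx L q) :=
    isUnit_of_coercive_s14 (sub_pos.2 hρ) (coercive_smul_one_add_Hxx hxx q)
  have hs' : fderiv ℝ p (x, y) (0, w)
      = -Ring.inverse (η • (1 : Eu n →L[ℝ] Eu n) + Hxx L q) (Hxy L q w) := by
    have h := congrArg (fun v => Ring.inverse (η • (1 : Eu n →L[ℝ] Eu n) + Hxx L q) v) hs
    simp only [] at h
    rw [← mul_apply_eq_comp, Ring.inverse_mul_cancel _ hunit] at h
    simpa using h
  have hd := hdom q w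
  have hval : fderiv ℝ (grady L) q (fderiv ℝ p (x, y) (0, w), w)
      = -(-(Hyy L q w)
        + Hyx L q (Ring.inverse (η • (1 : Eu n →L[ℝ] Eu n) + Hxx L q) (Hxy L q w))) := by
    rw [fderiv_grady_apply hL, hs', map_neg]
    abel
  have hgoal : ⟪fderiv ℝ (grady L) q (fderiv ℝ p (x, y) (0, w), w), w⟫ ≤ -α * ‖w‖ ^ 2 := by
    rw [hval, inner_neg_left]
    linarith
  exact hgoal

end ProximalMap

section Swap

variable {n m : ℕ} (L : Eu n × Eu m → ℝ) (z : Eu m × Eu n)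

lemma gradient_fun_neg {E : Type*} [NormedAddCommGroup E] [InnerProductSpace ℝ E]
    [CompleteSpace E] (f : E → ℝ) (x : E) : gradient (fun u => -f u) x = -gradient f x := by
  simp only [gradient, fderiv_fun_neg, map_neg]

lemma Hxx_neg_swap : Hxx (fun q : Eu m × Eu n => -L q.swap) z = -Hyy L z.swap := by
  simp only [Hxx, Hyy, Prod.swap, gradient_fun_neg, fderiv_fun_neg]

lemma Hyy_neg_swap : Hyy (fun q : Eu m × Eu n => -L q.swap) z = -Hxx L z.swap := by
  simp only [Hxx, Hyy, Prod.swap, gradient_fun_neg, fderiv_fun_neg]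

lemma Hxy_neg_swap : Hxy (fun q : Eu m × Eu n => -L q.swap) z = -Hyx L z.swap := by
  simp only [Hxy, Hyx, Prod.swap, gradient_fun_neg, fderiv_fun_neg]

lemma Hyx_neg_swap : Hyx (fun q : Eu m × Eu n => -L q.swap) z = -Hxy L z.swap := by
  simp only [Hxy, Hyx, Prod.swap, gradient_fun_neg, fderiv_fun_neg]

variable {L} in
lemma IntDomX.neg_swap {η α : ℝ} (h : IntDomX η α L) :
    IntDomY η α (fun q : Eu m × Eu n => -L q.swap) := by
  intro z w
  have := h z.swap w
  simpa [Hxx_neg_swap, Hyy_neg_swap, Hxy_neg_swap, Hyx_neg_swap, sub_eq_add_neg] using this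

end Swap

/-- Hessian bounds for the partial Moreau envelopes
g(x,y) = e_η{L(·,y)}(x) and h(x,y) = e_η{−L(x,·)}(y). -/
theorem statement14 {n m : ℕ}
    (L : Eu n × Eu m → ℝ) (ρ η α : ℝ)
    (hL : ContDiff ℝ 2 L)
    (hweak : WeaklyConvexConcave ρ L)
    (hη : max ρ 0 < η) :
    -- (a) bounds for ∇²ₓₓ g where g (x,y) = e_η{L(·,y)}(x)
    (∀ z : Eu n × Eu m, ∃ Hg : Eu n →L[ℝ] Eu n,
      HasFDerivAt (fun x => gradient (moreau η (fun u => L (u, z.2))) x) Hg z.1 ∧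
      ∀ v : Eu n,
        -(η * ρ) / (η - ρ) * ‖v‖ ^ 2 ≤ ⟪Hg v, v⟫ ∧ ⟪Hg v, v⟫ ≤ η * ‖v‖ ^ 2) ∧
    -- (b) if L is α-interaction dominant in y : gradient formula and
    -- ∇²_yy g ⪯ −αI
    (IntDomY η α L →
      ∀ z : Eu n × Eu m, ∃ xp : Eu n,
        (∀ u : Eu n, L (xp, z.2) + η / 2 * ‖xp - z.1‖ ^ 2 ≤
          L (u, z.2) + η / 2 * ‖u - z.1‖ ^ 2) ∧
        HasGradientAt (fun y => moreau η (fun u => L (u, y)) z.1)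
          (grady L (xp, z.2)) z.2 ∧
        ∃ Hg : Eu m →L[ℝ] Eu m,
          HasFDerivAt
            (fun y => gradient (fun y' => moreau η (fun u => L (u, y')) z.1) y)
            Hg z.2 ∧
          ∀ w : Eu m, ⟪Hg w, w⟫ ≤ -α * ‖w‖ ^ 2) ∧
    -- (c) bounds for ∇²_yy h where h (x,y) = e_η{−L(x,·)}(y)
    (∀ z : Eu n × Eu m, ∃ Hh : Eu m →L[ℝ] Eu m,
      HasFDerivAt (fun y => gradient (moreau η (fun v => -L (z.1, v))) y) Hh z.2 ∧
      ∀ w : Eu m,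
        -(η * ρ) / (η - ρ) * ‖w‖ ^ 2 ≤ ⟪Hh w, w⟫ ∧ ⟪Hh w, w⟫ ≤ η * ‖w‖ ^ 2) ∧
    -- (d) if L is α-interaction dominant in x : ∇²ₓₓ h ⪯ −αI
    (IntDomX η α L →
      ∀ z : Eu n × Eu m, ∃ Hh : Eu n →L[ℝ] Eu n,
        HasFDerivAt
          (fun x => gradient (fun x' => moreau η (fun v => -L (x', v)) z.2) x)
          Hh z.1 ∧
        ∀ v : Eu n, ⟪Hh v, v⟫ ≤ -α * ‖v‖ ^ 2) := by
  have hη0 : 0 < η := (le_max_right ρ 0).trans_lt hη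
  have hρ : ρ < η := (le_max_left ρ 0).trans_lt hη
  have hxx (z : Eu n × Eu m) (v : Eu n) := (hweak z).1 v
  have hL' : ContDiff ℝ 2 (fun q : Eu m × Eu n => -L q.swap) :=
    (hL.comp (contDiff_snd.prodMk contDiff_fst)).neg
  have hxx' (z : Eu m × Eu n) (v : Eu m) :
      -ρ * ‖v‖ ^ 2 ≤ ⟪Hxx (fun q : Eu m × Eu n => -L q.swap) z v, v⟫ := by
    rw [Hxx_neg_swap, neg_apply, inner_neg_left]
    linarith [(hweak z.swap).2 v]
  refine ⟨fun z => hessian_moreau_left_bounds hL hη0 hρ hxx z.1 z.2,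
    fun hdom z => gradient_hessian_moreau_right hL hη0 hρ hxx hdom z.1 z.2,
    fun z => hessian_moreau_left_bounds hL' hη0 hρ hxx' z.2 z.1, fun hdom z => ?_⟩
  obtain ⟨-, -, -, hH⟩ :=
    gradient_hessian_moreau_right hL' hη0 hρ hxx' hdom.neg_swap z.2 z.1
  exact hH

end
end

section
/- Let M : ℝⁿ × ℝᵐ → ℝ be differentiable and μ-strongly convex–strongly concave on the product of closed balls B(x,r) × B(y,r) for some fixed (x,y), where μ > 0 and r ≥ 2‖∇M(x,y)‖/μ. Then there exists a stationary point of M (a point where ∇M vanishes) in the closed ball of radius r/2 around (x,y). -/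
open Filter Topology Metric
open scoped RealInnerProductSpace

noncomputable section

/-- First-order lower bound for strongly convex functions. -/
lemma StrongConvexOn.add_fderiv_add_le {E : Type*} [NormedAddCommGroup E] [NormedSpace ℝ E]
    {s : Set E} {m : ℝ} {f : E → ℝ} {f' : E →L[ℝ] ℝ} {a b : E} (hf : StrongConvexOn s m f)
    (ha : a ∈ s) (hb : b ∈ s) (hf' : HasFDerivAt f f' a) :
    f a + f' (b - a) + m / 2 * ‖b - a‖ ^ 2 ≤ f b := by
  have hline : HasDerivAt (fun t : ℝ => f (a + t • (b - a))) (f' (b - a)) 0 :=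
    hf'.hasLineDerivAt (b - a)
  have hslope := hline.tendsto_slope_zero_right
  have hbound : Tendsto (fun t : ℝ => f b - f a - (1 - t) * (m / 2 * ‖b - a‖ ^ 2)) (𝓝[>] 0)
      (𝓝 (f b - f a - (1 - 0) * (m / 2 * ‖b - a‖ ^ 2))) :=
    (Continuous.tendsto (by fun_prop) 0).mono_left nhdsWithin_le_nhds
  have hle := le_of_tendsto_of_tendsto hslope hbound <| by
    filter_upwards [Ioo_mem_nhdsGT (zero_lt_one' ℝ)] with t ht
    have h := hf.2 ha hb (sub_nonneg.2 ht.2.le) ht.1.le (sub_add_cancel 1 t)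
    have hcomb : (1 - t) • a + t • b = a + t • (b - a) := by module
    rw [hcomb, norm_sub_rev a b] at h
    simp only [smul_eq_mul] at h
    simp only [zero_add, zero_smul, add_zero, smul_eq_mul]
    rw [inv_mul_le_iff₀ ht.1]
    linarith
  linarith

/-- Quadratic growth of a strongly convex function away from a minimizer. -/
lemma StrongConvexOn.add_le_of_isMinOn {E : Type*} [NormedAddCommGroup E] [NormedSpace ℝ E]
    {s : Set E} {m : ℝ} {f : E → ℝ} {a b : E} (hf : StrongConvexOn s m f)
    (ha : a ∈ s) (hb : b ∈ s) (hd : DifferentiableAt ℝ f a) (hmin : IsMinOn f s a) :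
    f a + m / 2 * ‖b - a‖ ^ 2 ≤ f b := by
  have hnonneg : 0 ≤ fderiv ℝ f a (b - a) :=
    hmin.localize.hasFDerivWithinAt_nonneg hd.hasFDerivAt.hasFDerivWithinAt
      (sub_mem_posTangentConeAt_of_segment_subset (hf.1.segment_subset ha hb))
  linarith [hf.add_fderiv_add_le ha hb hd.hasFDerivAt]

/-- A strongly convex–strongly concave function has a saddle point on a product of nonempty compact
sets, whose distance to any point of the product is controlled by the partial derivatives there. -/
lemma exists_isSaddlePointOn_of_strongConvexOn_strongConcaveOn
    {E F : Type*} [NormedAddCommGroup E] [NormedSpace ℝ E] [NormedAddCommGroup F] [NormedSpace ℝ F]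
    {X : Set E} {Y : Set F} {μ : ℝ} {f : E → F → ℝ} (hμ : 0 ≤ μ)
    (hX : IsCompact X) (hY : IsCompact Y)
    (hconv : ∀ y ∈ Y, StrongConvexOn X μ (fun x => f x y))
    (hconc : ∀ x ∈ X, StrongConcaveOn Y μ (f x))
    (hdx : ∀ y, Differentiable ℝ (fun x => f x y)) (hdy : ∀ x, Differentiable ℝ (f x))
    {x : E} {y : F} (hx : x ∈ X) (hy : y ∈ Y) :
    ∃ a ∈ X, ∃ b ∈ Y, IsSaddlePointOn X Y f a b ∧
      μ * (‖a - x‖ ^ 2 + ‖b - y‖ ^ 2) ≤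
        fderiv ℝ (f x) y (b - y) - fderiv ℝ (fun x => f x y) x (a - x) := by
  have hnonneg : (0 : ℝ → ℝ) ≤ fun r => μ / 2 * r ^ 2 := fun r => by positivity
  obtain ⟨a, ha, b, hb, hab⟩ := Sion.exists_isSaddlePointOn' (X := X) (Y := Y) (f := f)
    ⟨x, hx⟩ hX (fun y _ => (hdx y).continuous.continuousOn.lowerSemicontinuousOn)
    (fun y hy => ((hconv y hy).convexOn hnonneg).quasiconvexOn) (hconc x hx).1 hY
    (fun u _ => (hdy u).continuous.continuousOn.upperSemicontinuousOn)
    (fun x hx => ((hconc x hx).concaveOn hnonneg).quasiconcaveOn) (hconv y hy).1 ⟨y, hy⟩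
  refine ⟨a, ha, b, hb, hab, ?_⟩
  have hmin : IsMinOn (fun x => f x b) X a := fun u hu => hab u hu b hb
  have hneg : ∀ u ∈ X, StrongConvexOn Y μ (-f u) := fun u hu => UniformConcaveOn.neg (hconc u hu)
  have hmin' : IsMinOn (-f a) Y b := fun v hv => neg_le_neg (hab a ha v hv)
  have h1 := (hconv b hb).add_le_of_isMinOn ha hx (hdx b a) hmin
  have h2 := (hneg a ha).add_le_of_isMinOn hb hy (hdy a b).neg hmin'
  have h3 := (hconv y hy).add_fderiv_add_le hx ha (hdx y x).hasFDerivAt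
  have h4 := (hneg x hx).add_fderiv_add_le hy hb (hdy x y).hasFDerivAt.neg
  simp only [Pi.neg_apply, neg_apply] at h2 h4
  rw [norm_sub_rev x a] at h1
  rw [norm_sub_rev y b] at h2
  linarith

lemma fderiv_apply_eq_inner_gradient {E : Type*} [NormedAddCommGroup E] [InnerProductSpace ℝ E]
    [CompleteSpace E] {f : E → ℝ} (x v : E) : fderiv ℝ f x v = ⟪gradient f x, v⟫ := by
  simp [gradient]

lemma gradient_eq_zero_of_isLocalExtr {E : Type*} [NormedAddCommGroup E] [InnerProductSpace ℝ E]
    [CompleteSpace E] {f : E → ℝ} {x : E} (h : IsLocalExtr f x) : gradient f x = 0 := by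
  simp [gradient, h.fderiv_eq_zero]

/-- Cauchy–Schwarz inequality in the plane. -/
lemma mul_add_mul_le_sqrt_mul_sqrt (a b c d : ℝ) :
    a * b + c * d ≤ √(a ^ 2 + c ^ 2) * √(b ^ 2 + d ^ 2) := by
  rw [← Real.sqrt_mul (by positivity)]
  exact Real.le_sqrt_of_sq_le (by nlinarith [sq_nonneg (a * d - b * c)])

/-- existence of a stationary point of a locally strongly
convex–strongly concave function within a ball of half the radius. -/
theorem statement15 {n m : ℕ}
    (M : Eu n × Eu m → ℝ) (μ r : ℝ) (x : Eu n) (y : Eu m)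
    (hμ : 0 < μ)
    (hM : Differentiable ℝ M)
    (hconv : ∀ y' ∈ Metric.closedBall y r,
      ConvexOn ℝ (Metric.closedBall x r) (fun x' => M (x', y') - μ / 2 * ‖x'‖ ^ 2))
    (hconc : ∀ x' ∈ Metric.closedBall x r,
      ConcaveOn ℝ (Metric.closedBall y r) (fun y' => M (x', y') + μ / 2 * ‖y'‖ ^ 2))
    (hr : 2 * Real.sqrt (‖gradx M (x, y)‖ ^ 2 + ‖grady M (x, y)‖ ^ 2) / μ ≤ r) :
    ∃ zs : Eu n × Eu m,
      Real.sqrt (‖zs.1 - x‖ ^ 2 + ‖zs.2 - y‖ ^ 2) ≤ r / 2 ∧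
      gradx M zs = 0 ∧ grady M zs = 0 := by
  have hr0 : 0 ≤ r := le_trans (by positivity) hr
  rw [div_le_iff₀ hμ] at hr
  rcases hr0.eq_or_lt with rfl | hrpos
  · have hG : √(‖gradx M (x, y)‖ ^ 2 + ‖grady M (x, y)‖ ^ 2) ≤ 0 := by linarith
    rw [Real.sqrt_le_left le_rfl] at hG
    refine ⟨(x, y), by simp, ?_, ?_⟩ <;> rw [← norm_eq_zero] <;>
      nlinarith [sq_nonneg ‖gradx M (x, y)‖, sq_nonneg ‖grady M (x, y)‖]
  obtain ⟨a, ha, b, hb, hab, hdist⟩ :=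
    exists_isSaddlePointOn_of_strongConvexOn_strongConcaveOn (f := fun u v => M (u, v)) hμ.le
      (isCompact_closedBall x r) (isCompact_closedBall y r)
      (fun v hv => strongConvexOn_iff_convex.2 (hconv v hv))
      (fun u hu => strongConcaveOn_iff_convex.2 (hconc u hu))
      (fun v => hM.comp (by fun_prop)) (fun u => hM.comp (by fun_prop))
      (mem_closedBall_self hr0) (mem_closedBall_self hr0)
  have hbound : √(‖a - x‖ ^ 2 + ‖b - y‖ ^ 2) ≤ r / 2 := by
    set D := √(‖a - x‖ ^ 2 + ‖b - y‖ ^ 2) with hD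
    have hD2 : D ^ 2 = ‖a - x‖ ^ 2 + ‖b - y‖ ^ 2 := Real.sq_sqrt (by positivity)
    have hD0 : 0 ≤ D := Real.sqrt_nonneg _
    rw [fderiv_apply_eq_inner_gradient, fderiv_apply_eq_inner_gradient] at hdist
    change _ ≤ ⟪grady M (x, y), b - y⟫ - ⟪gradx M (x, y), a - x⟫ at hdist
    have h1 := real_inner_le_norm (grady M (x, y)) (b - y)
    have h2 := neg_le_of_abs_le (abs_real_inner_le_norm (gradx M (x, y)) (a - x))
    have h3 := mul_add_mul_le_sqrt_mul_sqrt
      ‖gradx M (x, y)‖ ‖a - x‖ ‖grady M (x, y)‖ ‖b - y‖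
    rw [← hD] at h3
    rw [← hD2] at hdist
    by_contra! hlt
    nlinarith [mul_pos hμ (sub_pos.2 hlt)]
  have hax : a ∈ ball x r := by
    rw [mem_ball_iff_norm]
    have := Real.le_sqrt_of_sq_le (le_add_of_nonneg_right (a := ‖a - x‖ ^ 2) (sq_nonneg ‖b - y‖))
    linarith
  have hby : b ∈ ball y r := by
    rw [mem_ball_iff_norm]
    have := Real.le_sqrt_of_sq_le (le_add_of_nonneg_left (a := ‖b - y‖ ^ 2) (sq_nonneg ‖a - x‖))
    linarith
  have hmin : IsMinOn (fun u => M (u, b)) (closedBall x r) a := fun u hu => hab u hu b hb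
  have hmax : IsMaxOn (fun v => M (a, v)) (closedBall y r) b := fun v hv => hab a ha v hv
  exact ⟨(a, b), hbound,
    gradient_eq_zero_of_isLocalExtr (hmin.isLocalMin (closedBall_mem_nhds_of_mem hax)).isExtr,
    gradient_eq_zero_of_isLocalExtr (hmax.isLocalMax (closedBall_mem_nhds_of_mem hby)).isExtr⟩

end
end

section
/- Fix ρ ≥ 0, a ∈ ℝ, η > ρ, and λ ∈ (0,1], and let L : ℝⁿ × ℝⁿ → ℝ be the quadratic L(x,y) = −(ρ/2)‖x‖² + a⟨x,y⟩ + (ρ/2)‖y‖². Set α = −ρ + a²/(η−ρ), C = 1 − λα/(η+α), and D = ληa/((η+α)(η−ρ)) (note η + α = η − ρ + a²/(η−ρ) > 0). Then the damped proximal point method iterates satisfy x_{k+1} = C·x_k − D·y_k and y_{k+1} = D·x_k + C·y_k, hence ‖(x_{k+1}, y_{k+1})‖² = (C² + D²)·‖(x_k, y_k)‖² for every k; consequently the iterates converge to the origin from every starting point if and only if C² + D² < 1. -/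
open Filter Topology Metric
open scoped RealInnerProductSpace

noncomputable section

theorem IsProxPoint.of_stationary {n : ℕ} {ρ a η : ℝ} (hη : ρ < η) {z w : Eu n × Eu n}
    (hx : (η - ρ) • w.1 + a • w.2 = η • z.1) (hy : (η - ρ) • w.2 - a • w.1 = η • z.2) :
    IsProxPoint η
      (fun z : Eu n × Eu n => -(ρ / 2) * ‖z.1‖ ^ 2 + a * ⟪z.1, z.2⟫ + ρ / 2 * ‖z.2‖ ^ 2) z w := by
  obtain ⟨x, y⟩ := z
  obtain ⟨u, v⟩ := w
  simp only at hx hy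
  have hpos : 0 ≤ η - ρ := sub_nonneg.2 hη.le
  refine ⟨fun v' => ?_, fun u' => ?_⟩
  · obtain ⟨d, rfl⟩ : ∃ d, v' = v + d := ⟨v' - v, by abel⟩
    have h := congrArg (fun t => ⟪t, d⟫) hy
    have hvd : v + d - y = (v - y) + d := by abel
    simp only [inner_sub_left, real_inner_smul_left] at h
    simp only [proxObj, hvd, norm_add_sq_real, inner_add_right, inner_sub_left]
    nlinarith [mul_nonneg hpos (sq_nonneg ‖d‖)]
  · obtain ⟨d, rfl⟩ : ∃ d, u' = u + d := ⟨u' - u, by abel⟩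
    have h := congrArg (fun t => ⟪t, d⟫) hx
    have hud : u + d - x = (u - x) + d := by abel
    simp only [inner_add_left, real_inner_smul_left] at h
    simp only [proxObj, hud, norm_add_sq_real, inner_add_left, inner_sub_left,
      real_inner_comm v d] at h ⊢
    nlinarith [mul_nonneg hpos (sq_nonneg ‖d‖)]

theorem norm_sq_add_norm_sq_rotation_scaling {E : Type*} [NormedAddCommGroup E]
    [InnerProductSpace ℝ E] (c d : ℝ) (x y : E) :
    ‖c • x - d • y‖ ^ 2 + ‖d • x + c • y‖ ^ 2 = (c ^ 2 + d ^ 2) * (‖x‖ ^ 2 + ‖y‖ ^ 2) := by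
  simp only [norm_sub_sq_real, norm_add_sq_real, norm_smul, mul_pow, Real.norm_eq_abs, sq_abs,
    real_inner_smul_left, real_inner_smul_right]
  ring

theorem tendsto_prod_zero_iff_norm_sq {ι E F : Type*} [SeminormedAddCommGroup E]
    [SeminormedAddCommGroup F] {l : Filter ι} {z : ι → E × F} :
    Tendsto z l (𝓝 0) ↔ Tendsto (fun k => ‖(z k).1‖ ^ 2 + ‖(z k).2‖ ^ 2) l (𝓝 0) := by
  constructor
  · intro h
    have hc : Continuous fun w : E × F => ‖w.1‖ ^ 2 + ‖w.2‖ ^ 2 := by fun_prop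
    simpa [Function.comp_def] using (hc.tendsto 0).comp h
  · intro h
    have hs := (Real.continuous_sqrt.tendsto 0).comp h
    rw [Real.sqrt_zero] at hs
    refine squeeze_zero_norm (fun k => ?_) hs
    exact norm_prod_le_iff.2 ⟨Real.le_sqrt_of_sq_le (le_add_of_nonneg_right (sq_nonneg _)),
      Real.le_sqrt_of_sq_le (le_add_of_nonneg_left (sq_nonneg _))⟩

/-- explicit dynamics of the damped proximal point method on the
nonconvex-nonconcave quadratic L(x,y) = −(ρ/2)‖x‖² + a⟨x,y⟩ + (ρ/2)‖y‖², and
the exact characterization of global convergence as C² + D² < 1. -/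
theorem statement16 {n : ℕ} (hn : 0 < n)
    (ρ a η lam α C D : ℝ)
    (hρ : 0 ≤ ρ) (hη : ρ < η) (hlam0 : 0 < lam) (hlam1 : lam ≤ 1)
    (L : Eu n × Eu n → ℝ)
    (hLdef : L = fun z => -(ρ / 2) * ‖z.1‖ ^ 2 + a * ⟪z.1, z.2⟫ + ρ / 2 * ‖z.2‖ ^ 2)
    (hα : α = -ρ + a ^ 2 / (η - ρ))
    (hC : C = 1 - lam * α / (η + α))
    (hD : D = lam * η * a / ((η + α) * (η - ρ)))
    (prox : Eu n × Eu n → Eu n × Eu n)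
    (hprox : ∀ z, IsProxPoint η L z (prox z))
    (hprox_uniq : ∀ z w, IsProxPoint η L z w → w = prox z) :
    (∀ z : ℕ → Eu n × Eu n,
      (∀ k, z (k + 1) = (1 - lam) • z k + lam • prox (z k)) →
      ∀ k, ((z (k + 1)).1 = C • (z k).1 - D • (z k).2 ∧
            (z (k + 1)).2 = D • (z k).1 + C • (z k).2) ∧
        ‖(z (k + 1)).1‖ ^ 2 + ‖(z (k + 1)).2‖ ^ 2 =
          (C ^ 2 + D ^ 2) * (‖(z k).1‖ ^ 2 + ‖(z k).2‖ ^ 2)) ∧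
    ((∀ z : ℕ → Eu n × Eu n,
        (∀ k, z (k + 1) = (1 - lam) • z k + lam • prox (z k)) →
        Tendsto z atTop (𝓝 0)) ↔ C ^ 2 + D ^ 2 < 1) := by
  subst hLdef
  have hs : 0 < η - ρ := sub_pos.2 hη
  have hT : η + α = ((η - ρ) ^ 2 + a ^ 2) / (η - ρ) := by
    rw [hα]
    field_simp
    ring
  have hN : (η - ρ) ^ 2 + a ^ 2 ≠ 0 := by positivity
  have hT0 : η + α ≠ 0 := hT ▸ div_ne_zero hN hs.ne'
  have hTs : (η + α) * (η - ρ) = (η - ρ) ^ 2 + a ^ 2 := by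
    rw [hT, div_mul_cancel₀ _ hs.ne']
  set p := η * (η - ρ) / ((η - ρ) ^ 2 + a ^ 2) with hp
  set q := η * a / ((η - ρ) ^ 2 + a ^ 2) with hq
  have hCp : C = 1 - lam + lam * p := by
    have hαη : α = (η + α) - η := by ring
    rw [hC, hαη, add_sub_cancel, hp, ← hTs]
    field_simp
    ring
  have hDq : D = lam * q := by rw [hD, hTs, hq]; ring
  have hpq₁ : (η - ρ) * p + a * q = η := by rw [hp, hq]; field_simp
  have hpq₂ : (η - ρ) * q = a * p := by rw [hp, hq]; ring
  have hproxeq (z : Eu n × Eu n) : prox z = (p • z.1 - q • z.2, q • z.1 + p • z.2) := by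
    refine (hprox_uniq z _ (.of_stationary hη ?_ ?_)).symm
    · linear_combination (norm := module) hpq₁ • z.1 - hpq₂ • z.2
    · linear_combination (norm := module) hpq₂ • z.1 + hpq₁ • z.2
  have hstep : ∀ z : ℕ → Eu n × Eu n,
      (∀ k, z (k + 1) = (1 - lam) • z k + lam • prox (z k)) →
      ∀ k, ((z (k + 1)).1 = C • (z k).1 - D • (z k).2 ∧
            (z (k + 1)).2 = D • (z k).1 + C • (z k).2) ∧
        ‖(z (k + 1)).1‖ ^ 2 + ‖(z (k + 1)).2‖ ^ 2 =
          (C ^ 2 + D ^ 2) * (‖(z k).1‖ ^ 2 + ‖(z k).2‖ ^ 2) := by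
    intro z hz k
    have h₁ : (z (k + 1)).1 = C • (z k).1 - D • (z k).2 := by
      rw [hz, hproxeq, hCp, hDq]
      simp only [Prod.fst_add, Prod.smul_fst]
      module
    have h₂ : (z (k + 1)).2 = D • (z k).1 + C • (z k).2 := by
      rw [hz, hproxeq, hCp, hDq]
      simp only [Prod.snd_add, Prod.smul_snd]
      module
    exact ⟨⟨h₁, h₂⟩, by rw [h₁, h₂, norm_sq_add_norm_sq_rotation_scaling]⟩
  have hpow : ∀ z : ℕ → Eu n × Eu n,
      (∀ k, z (k + 1) = (1 - lam) • z k + lam • prox (z k)) →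
      ∀ k, ‖(z k).1‖ ^ 2 + ‖(z k).2‖ ^ 2 =
        (C ^ 2 + D ^ 2) ^ k * (‖(z 0).1‖ ^ 2 + ‖(z 0).2‖ ^ 2) := by
    intro z hz k
    induction k with
    | zero => simp
    | succ k ih => rw [(hstep z hz k).2, ih]; ring
  have habs : |C ^ 2 + D ^ 2| = C ^ 2 + D ^ 2 := abs_of_nonneg (by positivity)
  refine ⟨hstep, fun h => ?_, fun h z hz => ?_⟩
  · have : Nonempty (Fin n) := ⟨⟨0, hn⟩⟩
    obtain ⟨e, he⟩ := exists_ne (0 : Eu n)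
    let z : ℕ → Eu n × Eu n :=
      fun k => (fun w => (1 - lam) • w + lam • prox w)^[k] (e, 0)
    have hz : ∀ k, z (k + 1) = (1 - lam) • z k + lam • prox (z k) :=
      fun k => Function.iterate_succ_apply' _ k _
    have hlim := tendsto_prod_zero_iff_norm_sq.1 (h z hz)
    have hr : ‖e‖ ^ 2 ≠ 0 := pow_ne_zero 2 (norm_ne_zero_iff.2 he)
    rw [funext (hpow z hz)] at hlim
    have hlim' := hlim.div_const (‖e‖ ^ 2)
    simp only [z, Function.iterate_zero, id_eq, norm_zero, ne_eq, OfNat.ofNat_ne_zero,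
      not_false_eq_true, zero_pow, add_zero, mul_div_cancel_right₀ _ hr, zero_div,
      tendsto_pow_atTop_nhds_zero_iff, habs] at hlim'
    exact hlim'
  · rw [tendsto_prod_zero_iff_norm_sq, funext (hpow z hz)]
    simpa using (tendsto_pow_atTop_nhds_zero_of_lt_one (by positivity) h).mul_const
      (‖(z 0).1‖ ^ 2 + ‖(z 0).2‖ ^ 2)

end
end

section
/- Fix ρ > 0, a ∈ ℝ, η > ρ, and let L : ℝⁿ × ℝⁿ → ℝ be the quadratic L(x,y) = −(ρ/2)‖x‖² + a⟨x,y⟩ + (ρ/2)‖y‖², with interaction dominance parameter α = −ρ + a²/(η−ρ). If α ≤ 0, then for every damping parameter λ ∈ (0,1] and every starting point z₀ ≠ 0, the damped proximal point iterates satisfy ‖z_{k+1}‖ > ‖z_k‖ for all k; in particular the method diverges and fails to converge to the unique stationary point at the origin. -/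
open Filter Topology Metric
open scoped RealInnerProductSpace

noncomputable section

/-- A linear form bounded below by the negative of a definite quadratic form vanishes. -/
lemma eq_zero_of_forall_nonneg_inner_add_sq {E : Type*} [NormedAddCommGroup E]
    [InnerProductSpace ℝ E] {c : ℝ} (hc : 0 < c) {g : E}
    (h : ∀ w : E, 0 ≤ ⟪g, w⟫ + c / 2 * ‖w‖ ^ 2) : g = 0 := by
  have hg := h (-(c⁻¹ • g))
  rw [inner_neg_right, real_inner_smul_right, real_inner_self_eq_norm_sq, norm_neg, norm_smul,
    mul_pow, Real.norm_eq_abs, sq_abs] at hg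
  have hsum : -(c⁻¹ * ‖g‖ ^ 2) + c / 2 * (c⁻¹ ^ 2 * ‖g‖ ^ 2) = -(c⁻¹ / 2 * ‖g‖ ^ 2) := by
    field_simp
    ring
  rw [hsum] at hg
  have hc' : 0 < c⁻¹ / 2 := by positivity
  have hle : ‖g‖ ^ 2 ≤ 0 := by
    by_contra! hpos
    linarith [mul_pos hc' hpos]
  exact norm_eq_zero.mp (pow_eq_zero_iff two_ne_zero |>.mp (le_antisymm hle (sq_nonneg _)))

/-- The quadratic saddle function with weak convexity constant `ρ` and coupling `a`. -/
def quadSaddle (n : ℕ) (ρ a : ℝ) (z : Eu n × Eu n) : ℝ :=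
  -(ρ / 2) * ‖z.1‖ ^ 2 + a * ⟪z.1, z.2⟫ + ρ / 2 * ‖z.2‖ ^ 2

lemma IsProxPoint.stationary_quadSaddle {n : ℕ} {ρ a η : ℝ} (hη : ρ < η) {z w : Eu n × Eu n}
    (h : IsProxPoint η (quadSaddle n ρ a) z w) :
    (η - ρ) • w.1 + a • w.2 = η • z.1 ∧ (η - ρ) • w.2 - a • w.1 = η • z.2 := by
  have hd : 0 < η - ρ := sub_pos.mpr hη
  obtain ⟨hmax, hmin⟩ := h
  constructor
  · rw [← sub_eq_zero]
    refine eq_zero_of_forall_nonneg_inner_add_sq hd fun p => ?_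
    have hp := hmin (w.1 + p)
    simp only [proxObj, quadSaddle, ← real_inner_self_eq_norm_sq, inner_add_left, inner_add_right,
      inner_sub_left, inner_sub_right, real_inner_smul_left] at hp ⊢
    simp only [real_inner_comm w.1 p, real_inner_comm z.1 p, real_inner_comm w.2 p] at hp
    linarith
  · rw [← sub_eq_zero]
    refine eq_zero_of_forall_nonneg_inner_add_sq hd fun p => ?_
    have hp := hmax (w.2 + p)
    simp only [proxObj, quadSaddle, ← real_inner_self_eq_norm_sq, inner_add_left, inner_add_right,
      inner_sub_left, inner_sub_right, real_inner_smul_left] at hp ⊢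
    simp only [real_inner_comm w.2 p, real_inner_comm z.2 p] at hp
    linarith

lemma IsProxPoint.eq_quadSaddle {n : ℕ} {ρ a η : ℝ} (hη : ρ < η) {z w : Eu n × Eu n}
    (h : IsProxPoint η (quadSaddle n ρ a) z w) :
    w.1 = (η * (η - ρ) / ((η - ρ) ^ 2 + a ^ 2)) • z.1 -
        (η * a / ((η - ρ) ^ 2 + a ^ 2)) • z.2 ∧
      w.2 = (η * a / ((η - ρ) ^ 2 + a ^ 2)) • z.1 +
        (η * (η - ρ) / ((η - ρ) ^ 2 + a ^ 2)) • z.2 := by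
  have hd : 0 < η - ρ := sub_pos.mpr hη
  have hN : (η - ρ) ^ 2 + a ^ 2 ≠ 0 := by positivity
  obtain ⟨h₁, h₂⟩ := h.stationary_quadSaddle hη
  have hu : ((η - ρ) ^ 2 + a ^ 2) • w.1 = η • ((η - ρ) • z.1 - a • z.2) := by
    linear_combination (norm := module) (η - ρ) • h₁ - a • h₂
  have hv : ((η - ρ) ^ 2 + a ^ 2) • w.2 = η • (a • z.1 + (η - ρ) • z.2) := by
    linear_combination (norm := module) a • h₁ + (η - ρ) • h₂
  rw [← eq_inv_smul_iff₀ hN] at hu hv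
  rw [hu, hv]
  constructor <;> module

lemma norm_sq_add_norm_sq_rotation {E : Type*} [NormedAddCommGroup E] [InnerProductSpace ℝ E]
    (C D : ℝ) (x y : E) :
    ‖C • x - D • y‖ ^ 2 + ‖D • x + C • y‖ ^ 2 = (C ^ 2 + D ^ 2) * (‖x‖ ^ 2 + ‖y‖ ^ 2) := by
  rw [norm_sub_sq_real, norm_add_sq_real]
  simp only [norm_smul, mul_pow, Real.norm_eq_abs, sq_abs, real_inner_smul_left,
    real_inner_smul_right]
  ring

/-- The squared modulus of the damped step multiplier exceeds one when the interaction
is weak. -/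
lemma one_lt_damped_multiplier {ρ a η lam : ℝ} (hρ : 0 < ρ) (hη : ρ < η) (hlam : 0 < lam)
    (ha : a ^ 2 ≤ ρ * (η - ρ)) :
    1 < (1 - lam + lam * (η * (η - ρ) / ((η - ρ) ^ 2 + a ^ 2))) ^ 2 +
      (lam * (η * a / ((η - ρ) ^ 2 + a ^ 2))) ^ 2 := by
  have hd : 0 < η - ρ := sub_pos.mpr hη
  have hη0 : 0 < η := hρ.trans hη
  have hN : 0 < (η - ρ) ^ 2 + a ^ 2 := by positivity
  rcases eq_or_ne a 0 with rfl | ha0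
  · have hq : 1 < η * (η - ρ) / ((η - ρ) ^ 2 + 0 ^ 2) := by
      rw [one_lt_div hN]
      nlinarith
    have hC := mul_pos hlam (sub_pos.mpr hq)
    nlinarith [sq_nonneg (lam * (η * 0 / ((η - ρ) ^ 2 + 0 ^ 2)))]
  · have hq : 1 ≤ η * (η - ρ) / ((η - ρ) ^ 2 + a ^ 2) := by
      rw [one_le_div hN]
      nlinarith
    have hC := mul_nonneg hlam.le (sub_nonneg.mpr hq)
    have hD : 0 < (lam * (η * a / ((η - ρ) ^ 2 + a ^ 2))) ^ 2 := by positivity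
    nlinarith

/-- when the interaction dominance parameter α = −ρ + a²/(η−ρ) is
nonpositive, the damped proximal point method on the quadratic
L(x,y) = −(ρ/2)‖x‖² + a⟨x,y⟩ + (ρ/2)‖y‖² strictly increases in norm and
fails to converge to the origin, for every damping λ ∈ (0,1] and every
starting point z₀ ≠ 0. -/
theorem statement17 {n : ℕ}
    (ρ a η α : ℝ)
    (hρ : 0 < ρ) (hη : ρ < η)
    (L : Eu n × Eu n → ℝ)
    (hLdef : L = fun z => -(ρ / 2) * ‖z.1‖ ^ 2 + a * ⟪z.1, z.2⟫ + ρ / 2 * ‖z.2‖ ^ 2)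
    (hα : α = -ρ + a ^ 2 / (η - ρ))
    (hα0 : α ≤ 0)
    (prox : Eu n × Eu n → Eu n × Eu n)
    (hprox : ∀ z, IsProxPoint η L z (prox z))
    (hprox_uniq : ∀ z w, IsProxPoint η L z w → w = prox z) :
    ∀ lam : ℝ, 0 < lam → lam ≤ 1 →
      ∀ z : ℕ → Eu n × Eu n, z 0 ≠ 0 →
        (∀ k, z (k + 1) = (1 - lam) • z k + lam • prox (z k)) →
        (∀ k, Real.sqrt (‖(z k).1‖ ^ 2 + ‖(z k).2‖ ^ 2) <
          Real.sqrt (‖(z (k + 1)).1‖ ^ 2 + ‖(z (k + 1)).2‖ ^ 2)) ∧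
        ¬ Tendsto z atTop (𝓝 0) := by
  have hL : L = quadSaddle n ρ a := hLdef
  subst hL
  intro lam hlam _ z hz0 hz
  have hd : 0 < η - ρ := sub_pos.mpr hη
  have ha : a ^ 2 ≤ ρ * (η - ρ) := by
    rw [← div_le_iff₀ hd]
    linarith
  have hgrow := one_lt_damped_multiplier hρ hη hlam ha
  set q := η * (η - ρ) / ((η - ρ) ^ 2 + a ^ 2) with hq
  set r := η * a / ((η - ρ) ^ 2 + a ^ 2) with hr
  let S : Eu n × Eu n → ℝ := fun w => ‖w.1‖ ^ 2 + ‖w.2‖ ^ 2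
  have hstep : ∀ k, S (z (k + 1)) = ((1 - lam + lam * q) ^ 2 + (lam * r) ^ 2) * S (z k) := by
    intro k
    obtain ⟨hu, hv⟩ := (hprox (z k)).eq_quadSaddle hη
    rw [← hq, ← hr] at hu hv
    have hx : (z (k + 1)).1 = (1 - lam + lam * q) • (z k).1 - (lam * r) • (z k).2 := by
      rw [hz k, Prod.fst_add, Prod.smul_fst, Prod.smul_fst, hu]
      module
    have hy : (z (k + 1)).2 = (lam * r) • (z k).1 + (1 - lam + lam * q) • (z k).2 := by
      rw [hz k, Prod.snd_add, Prod.smul_snd, Prod.smul_snd, hv]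
      module
    simp only [S, hx, hy, norm_sq_add_norm_sq_rotation]
  have hS0 : 0 < S (z 0) := by
    rcases not_and_or.mp (Prod.ext_iff.not.mp hz0) with h | h
    · have := norm_pos_iff.mpr h
      positivity
    · have := norm_pos_iff.mpr h
      positivity
  have hpos : ∀ k, 0 < S (z k) := by
    intro k
    induction k with
    | zero => exact hS0
    | succ k ih =>
      rw [hstep]
      exact mul_pos (one_pos.trans hgrow) ih
  have hlt : ∀ k, S (z k) < S (z (k + 1)) := fun k => by
    rw [hstep]
    exact lt_mul_of_one_lt_left (hpos k) hgrow
  refine ⟨fun k => Real.sqrt_lt_sqrt (hpos k).le (hlt k), fun hlim => ?_⟩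
  have hcont : Continuous S := by fun_prop
  have hSlim : Tendsto (fun k => S (z k)) atTop (𝓝 (S 0)) := (hcont.tendsto 0).comp hlim
  have hle : S (z 0) ≤ S 0 :=
    ge_of_tendsto' hSlim fun k => (strictMono_nat_of_lt_succ hlt).monotone (Nat.zero_le k)
  have hzero : S 0 = 0 := by simp [S]
  linarith

end
end
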